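/- arXiv:2010.05476 — 3 statements merged into one kernel-verified Lean document; each statement's English description precedes it below -/
import Mathlib

section
/- For all n, k ≥ 1 with λ_n > λ (so that μ_n := √(λ_n − λ)/κ is a positive real) and λ_k − λ_n + λ ≠ 0, one has the exact identity ∫₀¹ (φ_n(x) − ξ̃_n(x)) φ_k(x) dx = δ_{kn} + (2 j_{ν,k} κ² / ((λ_k − λ_n + λ) J_ν′(j_{ν,n}))) · J_ν(μ_n), where δ_{kn} is the Kronecker symbol. -/
open MeasureTheory Real Set

/-- The Bessel function of the first kind of order `ν ≥ 0`, defined by its power series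
`J_ν(x) = ∑_{m≥0} (-1)^m / (m! Γ(m+ν+1)) (x/2)^(2m+ν)`. -/
noncomputable def besselJ (ν : ℝ) (x : ℝ) : ℝ :=
  ∑' m : ℕ, ((-1 : ℝ) ^ m / ((m.factorial : ℝ) * Real.Gamma ((m : ℝ) + ν + 1))) *
    (x / 2) ^ (2 * (m : ℝ) + ν)

open Filter Topology in
/-- Termwise differentiation of an everywhere convergent power series. -/
lemma bj_series_deriv (c : ℕ → ℝ) (hc : ∀ r : ℝ, 0 ≤ r → Summable (fun m => |c m| * r ^ m)) :
    (∀ r : ℝ, 0 ≤ r → Summable (fun m : ℕ => |((m:ℝ) + 1) * c (m+1)| * r ^ m)) ∧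
    ∀ z : ℝ, HasDerivAt (fun z => ∑' m : ℕ, c m * z ^ m)
      (∑' m : ℕ, (((m:ℝ) + 1) * c (m+1)) * z ^ m) z := by
  have h1 : ∀ r : ℝ, 0 ≤ r → Summable (fun m : ℕ => |((m:ℝ) + 1) * c (m+1)| * r ^ m) := by
    intro r hr
    have h := (summable_nat_add_iff 1).2 (hc (2 * (r + 1)) (by positivity))
    refine Summable.of_nonneg_of_le (fun m => by positivity) (fun m => ?_) h
    have e : ((m:ℝ) + 1) ≤ 2 ^ (m+1) := by
      have : m + 1 < 2 ^ (m+1) := Nat.lt_two_pow_self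
      exact_mod_cast this.le
    have e2 : r ^ m ≤ (r+1) ^ (m+1) := by
      calc r ^ m ≤ (r+1)^m := by gcongr; linarith
        _ ≤ (r+1)^(m+1) := pow_le_pow_right₀ (by linarith) (by omega)
    rw [abs_mul, abs_of_nonneg (by positivity : (0:ℝ) ≤ (m:ℝ)+1), mul_pow]
    calc ((m:ℝ)+1) * |c (m+1)| * r ^ m = |c (m+1)| * (((m:ℝ)+1) * r^m) := by ring
      _ ≤ _ := by gcongr
  refine ⟨h1, fun z => ?_⟩
  have hR : 0 ≤ |z| + 1 := by positivity
  have hsum : ∀ w : ℝ, Summable (fun m => c m * w ^ m) := fun w => by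
    refine Summable.of_norm ?_
    simpa [abs_mul, abs_pow] using hc |w| (abs_nonneg w)
  have hu : Summable (fun m : ℕ => |(m:ℝ) * c m| * (|z|+1) ^ (m-1)) := by
    refine (summable_nat_add_iff 1).1 ?_
    simpa using h1 _ hR
  have key := hasDerivAt_tsum_of_isPreconnected (g := fun m w => c m * w ^ m)
    (g' := fun m w => c m * ((m:ℝ) * w ^ (m-1))) (t := Metric.ball (0:ℝ) (|z|+1)) (y₀ := 0) (y := z)
    hu Metric.isOpen_ball (convex_ball _ _).isPreconnected
    (fun m y _ => (hasDerivAt_pow m y).const_mul (c m))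
    (fun m y hy => ?_) (by simp; positivity) (hsum 0) (by simp)
  · refine key.congr_deriv (Eq.symm ?_)
    have hs : Summable (fun m : ℕ => c m * ((m:ℝ) * z ^ (m-1))) := by
      refine Summable.of_norm_bounded hu (fun m => ?_)
      rw [Real.norm_eq_abs, ← mul_assoc, abs_mul, abs_pow, mul_comm (c m)]
      gcongr; linarith
    rw [hs.tsum_eq_zero_add]
    simp only [Nat.cast_zero, zero_mul, mul_zero, zero_add, Nat.add_sub_cancel]
    refine tsum_congr fun m => ?_
    push_cast; ring
  · have hy' : |y| ≤ |z| + 1 := by simpa using (Metric.mem_ball.1 hy).le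
    rw [Real.norm_eq_abs, ← mul_assoc, abs_mul, abs_pow, mul_comm (c m)]
    gcongr

/-- Entire part of the Bessel function and its properties. -/
lemma bj_exists (ν : ℝ) (hν : 0 < ν) : ∃ G G1 G2 : ℝ → ℝ,
    (∀ z, HasDerivAt G (G1 z) z) ∧ (∀ z, HasDerivAt G1 (G2 z) z) ∧
    (∀ z, z * G2 z + (ν + 1) * G1 z + G z = 0) ∧ 0 < G 0 ∧
    (∀ x, 0 ≤ x → besselJ ν x = (x/2) ^ ν * G (x^2/4)) := by
  set c : ℕ → ℝ := fun m => (-1 : ℝ) ^ m / ((m.factorial : ℝ) * Real.Gamma ((m : ℝ) + ν + 1)) with hcdef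
  have hGpos : ∀ m : ℕ, 0 < Real.Gamma ((m:ℝ) + ν + 1) := fun m => Real.Gamma_pos_of_pos (by positivity)
  have hGrec : ∀ m : ℕ, Real.Gamma (((m+1:ℕ):ℝ) + ν + 1) = ((m:ℝ) + ν + 1) * Real.Gamma ((m:ℝ) + ν + 1) := by
    intro m
    rw [← Real.Gamma_add_one (by positivity)]
    push_cast; ring_nf
  have hGlow : ∀ m : ℕ, Real.Gamma (ν + 1) ≤ Real.Gamma ((m:ℝ) + ν + 1) := by
    intro m
    induction m with
    | zero => simp
    | succ m ih =>
      rw [hGrec]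
      have : (1:ℝ) ≤ (m:ℝ) + ν + 1 := by have : (0:ℝ) ≤ m := by positivity
                                         linarith
      nlinarith [hGpos m]
  have hG0 : 0 < Real.Gamma (ν + 1) := Real.Gamma_pos_of_pos (by positivity)
  have hc : ∀ r : ℝ, 0 ≤ r → Summable (fun m => |c m| * r ^ m) := by
    intro r hr
    have h := (Real.summable_pow_div_factorial r).mul_left (1 / Real.Gamma (ν+1))
    refine Summable.of_nonneg_of_le (fun m => by positivity) (fun m => ?_) h
    have : |c m| = 1 / ((m.factorial : ℝ) * Real.Gamma ((m : ℝ) + ν + 1)) := by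
      rw [hcdef]; simp only
      rw [abs_div, abs_pow, abs_neg, abs_one, one_pow, abs_of_pos (by have := hGpos m; positivity)]
    rw [this]
    calc _ ≤ 1 / ((m.factorial : ℝ) * Real.Gamma (ν + 1)) * r^m := by gcongr; exact hGlow m
      _ = _ := by field_simp
  obtain ⟨hd, hder⟩ := bj_series_deriv c hc
  obtain ⟨he, hder2⟩ := bj_series_deriv _ hd
  refine ⟨_, _, _, hder, hder2, ?_, ?_, ?_⟩
  · intro z
    have hs : ∀ a : ℕ → ℝ, (∀ r : ℝ, 0 ≤ r → Summable (fun m => |a m| * r ^ m)) →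
        Summable (fun m => a m * z ^ m) := fun a ha => by
      refine Summable.of_norm ?_
      simpa [abs_mul, abs_pow] using ha |z| (abs_nonneg z)
    have s0 := hs _ hc
    have s1 := hs _ hd
    have s2 := hs _ he
    have s3 : Summable (fun m : ℕ => (m:ℝ) * (((m:ℝ) + 1) * c (m+1)) * z ^ m) := by
      refine (summable_nat_add_iff 1).1 ?_
      refine (s2.mul_left z).congr (fun m => ?_)
      push_cast; ring
    have e : z * ∑' m : ℕ, ((m:ℝ) + 1) * ((((m+1:ℕ):ℝ) + 1) * c (m+1+1)) * z ^ m
        = ∑' m : ℕ, (m:ℝ) * (((m:ℝ) + 1) * c (m+1)) * z ^ m := by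
      rw [s3.tsum_eq_zero_add, ← tsum_mul_left]
      simp only [Nat.cast_zero, zero_mul, zero_add]
      refine tsum_congr fun m => ?_
      push_cast; ring
    rw [e, ← tsum_mul_left, ← s3.tsum_add (s1.mul_left _), ← (s3.add (s1.mul_left _)).tsum_add s0]
    convert tsum_zero with m
    have : c m = - (((m:ℝ)+1) * ((m:ℝ)+ν+1) * c (m+1)) := by
      rw [hcdef]; simp only
      rw [hGrec, Nat.factorial_succ, pow_succ]
      have := hGpos m
      have h2 : (m:ℝ)+ν+1 ≠ 0 := by positivity
      push_cast
      field_simp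
    rw [this]; ring
  · have : ∑' m : ℕ, c m * (0:ℝ) ^ m = c 0 := by
      rw [tsum_eq_single 0]
      · simp
      · intro m hm; simp [hm]
    have h2 : 0 < c 0 := by simpa [hcdef] using hG0
    simpa only [this] using h2
  · intro x hx
    unfold besselJ
    rw [← tsum_mul_left]
    refine tsum_congr fun m => ?_
    have : (x/2) ^ (2 * (m:ℝ) + ν) = (x/2)^ν * (x^2/4)^m := by
      rw [Real.rpow_add_of_nonneg (by positivity) (by positivity) hν.le]
      rw [show 2 * (m:ℝ) = ((2*m : ℕ):ℝ) by push_cast; ring, Real.rpow_natCast, pow_mul]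
      rw [mul_comm]; congr 2; ring
    rw [this]; simp only [hcdef]; ring

/-- The two integrals. -/
lemma bj_integrals (α ν : ℝ) (hα : α ∈ Set.Ioo (0:ℝ) 1) (hν : ν = (1 - α) / (2 - α))
    (G G1 G2 : ℝ → ℝ)
    (hG : ∀ z, HasDerivAt G (G1 z) z) (hG1 : ∀ z, HasDerivAt G1 (G2 z) z)
    (hode : ∀ z, z * G2 z + (ν + 1) * G1 z + G z = 0) :
    (∀ p q : ℝ, (2 - α) * (q - p) * ∫ x in (0:ℝ)..1,
      (x ^ (1 - α) * G (p * x ^ (2 - α))) * (x ^ (1 - α) * G (q * x ^ (2 - α)))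
      = p * G1 p * G q - q * G p * G1 q) ∧
    (∀ p : ℝ, (2 - α) * ∫ x in (0:ℝ)..1,
      (x ^ (1 - α) * G (p * x ^ (2 - α))) * (x ^ (1 - α) * G (p * x ^ (2 - α)))
      = p * G1 p ^ 2 + ν * G p * G1 p + G p ^ 2) := by
  obtain ⟨h0, h1⟩ := hα
  have cG : Continuous G := continuous_iff_continuousAt.2 fun z => (hG z).continuousAt
  have cG1 : Continuous G1 := continuous_iff_continuousAt.2 fun z => (hG1 z).continuousAt
  have cx : ∀ r : ℝ, 0 ≤ r → Continuous (fun x : ℝ => x ^ r) := fun r hr => Real.continuous_rpow_const hr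
  have c1 := cx (1 - α) (by linarith)
  have c2 := cx (2 - α) (by linarith)
  have c3 := cx (3 - 2 * α) (by linarith)
  have hνα : ν * (2 - α) = 1 - α := by rw [hν]; field_simp [show (2 - α) ≠ 0 by linarith]
  have d2 : ∀ x : ℝ, 0 < x → HasDerivAt (fun x : ℝ => x ^ (2 - α)) ((2 - α) * x ^ (1 - α)) x := by
    intro x hx
    have := Real.hasDerivAt_rpow_const (x := x) (p := 2 - α) (Or.inl hx.ne')
    convert this using 2; ring_nf
  have d3 : ∀ x : ℝ, 0 < x → HasDerivAt (fun x : ℝ => x ^ (3 - 2 * α))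
      ((3 - 2 * α) * (x ^ (1 - α)) ^ 2) x := by
    intro x hx
    have := Real.hasDerivAt_rpow_const (x := x) (p := 3 - 2 * α) (Or.inl hx.ne')
    convert this using 2
    rw [← Real.rpow_natCast, ← Real.rpow_mul hx.le]; push_cast; ring_nf
  have e3 : ∀ x : ℝ, 0 < x → x ^ (3 - 2 * α) = x ^ (1 - α) * x ^ (2 - α) := by
    intro x hx
    rw [← Real.rpow_add hx]; ring_nf
  have dG : ∀ p x : ℝ, 0 < x → HasDerivAt (fun x : ℝ => G (p * x ^ (2 - α)))
      (G1 (p * x ^ (2 - α)) * (p * ((2 - α) * x ^ (1 - α)))) x := fun p x hx =>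
    (hG _).comp x ((d2 x hx).const_mul p)
  have dG1 : ∀ p x : ℝ, 0 < x → HasDerivAt (fun x : ℝ => G1 (p * x ^ (2 - α)))
      (G2 (p * x ^ (2 - α)) * (p * ((2 - α) * x ^ (1 - α)))) x := fun p x hx =>
    (hG1 _).comp x ((d2 x hx).const_mul p)
  have z3 : (0:ℝ) ^ (3 - 2 * α) = 0 := Real.zero_rpow (by linarith)
  have h32 : 3 - 2 * α = (ν + 1) * (2 - α) := by linear_combination -hνα
  constructor
  · intro p q
    rw [← intervalIntegral.integral_const_mul]
    have := intervalIntegral.integral_eq_sub_of_hasDerivAt_of_le (a := 0) (b := 1) zero_le_one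
      (f := fun x : ℝ => x ^ (3 - 2 * α) * (p * G1 (p * x ^ (2 - α)) * G (q * x ^ (2 - α))
        - q * G (p * x ^ (2 - α)) * G1 (q * x ^ (2 - α))))
      (f' := fun x : ℝ => (2 - α) * (q - p) * ((x ^ (1 - α) * G (p * x ^ (2 - α))) *
        (x ^ (1 - α) * G (q * x ^ (2 - α)))))
      (by fun_prop) ?_ (Continuous.intervalIntegrable (by fun_prop) _ _)
    · rw [this]; simp [z3]
    · rintro x ⟨hx, -⟩
      have D := (d3 x hx).mul ((((dG1 p x hx).const_mul p).mul (dG q x hx)).sub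
        (((dG p x hx).const_mul q).mul (dG1 q x hx)))
      refine D.congr_deriv (Eq.symm ?_)
      have o1 := hode (p * x ^ (2 - α))
      have o2 := hode (q * x ^ (2 - α))
      try simp only [Pi.sub_apply, Pi.mul_apply]
      rw [e3 x hx, h32]
      generalize x ^ (1 - α) = y at *
      generalize x ^ (2 - α) = t at *
      linear_combination (-(y^2 * (2 - α) * p * G (q * t))) * o1 + (y^2 * (2 - α) * q * G (p * t)) * o2
  · intro p
    rw [← intervalIntegral.integral_const_mul]
    have := intervalIntegral.integral_eq_sub_of_hasDerivAt_of_le (a := 0) (b := 1) zero_le_one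
      (f := fun x : ℝ => x ^ (3 - 2 * α) * (p * x ^ (2 - α) * G1 (p * x ^ (2 - α)) ^ 2
        + ν * G (p * x ^ (2 - α)) * G1 (p * x ^ (2 - α)) + G (p * x ^ (2 - α)) ^ 2))
      (f' := fun x : ℝ => (2 - α) * ((x ^ (1 - α) * G (p * x ^ (2 - α))) *
        (x ^ (1 - α) * G (p * x ^ (2 - α)))))
      (by fun_prop) ?_ (Continuous.intervalIntegrable (by fun_prop) _ _)
    · rw [this]; simp [z3]
    · rintro x ⟨hx, -⟩
      have D := (d3 x hx).mul (((((d2 x hx).const_mul p).mul ((dG1 p x hx).pow 2)).add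
        (((dG p x hx).const_mul ν).mul (dG1 p x hx))).add ((dG p x hx).pow 2))
      refine D.congr_deriv (Eq.symm ?_)
      have o1 := hode (p * x ^ (2 - α))
      try simp only [Pi.add_apply, Pi.mul_apply, Pi.pow_apply]
      rw [e3 x hx, h32]
      generalize x ^ (1 - α) = y at *
      generalize x ^ (2 - α) = t at *
      push_cast
      linear_combination (-(y^2 * (2 - α)) * (2 * p * t * G1 (p*t) + ν * G (p * t))) * o1

/-- For all `n, k ≥ 1` with `λ_n > λ` (so that `μ_n := √(λ_n - λ)/κ > 0`) and
`λ_k - λ_n + λ ≠ 0`, one has the exact identity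
`∫₀¹ (φ_n - ξ̃_n) φ_k dx = δ_{kn} + (2 j_{ν,k} κ² / ((λ_k - λ_n + λ) J_ν'(j_{ν,n}))) J_ν(μ_n)`. -/
theorem stmt_10 (α ν κ : ℝ) (hα : α ∈ Set.Ioo (0:ℝ) 1)
    (hν : ν = (1 - α) / (2 - α)) (hκ : κ = (2 - α) / 2)
    (j : ℕ → ℝ)
    (hjpos : ∀ n, 1 ≤ n → 0 < j n)
    (hjmono : ∀ m n, 1 ≤ m → m < n → j m < j n)
    (hjzero : ∀ n, 1 ≤ n → besselJ ν (j n) = 0)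
    (hjtop : Filter.Tendsto j Filter.atTop Filter.atTop)
    (ev : ℕ → ℝ) (hev : ∀ n, ev n = (κ * j n) ^ 2)
    (lam : ℝ) (hlam : 0 < lam)
    (hnr1 : ∀ n, 1 ≤ n → lam ≠ ev n)
    (hnr2 : ∀ n k, 1 ≤ n → 1 ≤ k → lam - ev n ≠ ev k)
    (φ : ℕ → ℝ → ℝ)
    (hφ : ∀ n x, φ n x = Real.sqrt (2 * κ) * x ^ ((1 - α) / 2) *
      besselJ ν (j n * x ^ κ) / deriv (besselJ ν) (j n))
    (ξ : ℕ → ℝ → ℝ)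
    (hξ : ∀ n x, ξ n x = Real.sqrt (2 * κ) * x ^ ((1 - α) / 2) *
      besselJ ν ((Real.sqrt (ev n - lam) / κ) * x ^ κ) / deriv (besselJ ν) (j n))
    (n k : ℕ) (hn : 1 ≤ n) (hk : 1 ≤ k) (hgap : lam < ev n)
    (hden : ev k - ev n + lam ≠ 0) :
    ∫ x in (0:ℝ)..1, (φ n x - ξ n x) * φ k x =
      (if k = n then (1:ℝ) else 0) +
        (2 * j k * κ ^ 2 / ((ev k - ev n + lam) * deriv (besselJ ν) (j n))) *
          besselJ ν (Real.sqrt (ev n - lam) / κ) := by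
  obtain ⟨h0, h1⟩ := id hα
  have hν0 : 0 < ν := by rw [hν]; exact div_pos (by linarith) (by linarith)
  have hκ0 : 0 < κ := by rw [hκ]; linarith
  obtain ⟨G, G1, G2, hG, hG1, hode, hGpos, hJ⟩ := bj_exists ν hν0
  obtain ⟨hI, hI2⟩ := bj_integrals α ν hα hν G G1 G2 hG hG1 hode
  have cG : Continuous G := continuous_iff_continuousAt.2 fun z => (hG z).continuousAt
  have hA : ∀ a : ℝ, 0 < a → 0 < (a/2) ^ ν := fun a ha => Real.rpow_pos_of_pos (by positivity) _
  have hz : ∀ m, 1 ≤ m → G (j m ^ 2 / 4) = 0 := by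
    intro m hm
    have h := hjzero m hm
    rw [hJ _ (hjpos m hm).le] at h
    exact (mul_eq_zero.1 h).resolve_left (hA _ (hjpos m hm)).ne'
  have hD : ∀ m, 1 ≤ m → deriv (besselJ ν) (j m) = (j m / 2) ^ ν * (G1 (j m ^ 2 / 4) * (j m / 2)) := by
    intro m hm
    have hp := hjpos m hm
    have e : besselJ ν =ᶠ[nhds (j m)] fun x => (x/2) ^ ν * G (x^2/4) := by
      filter_upwards [lt_mem_nhds hp] with x hx using hJ x hx.le
    rw [e.deriv_eq]
    have d1 : HasDerivAt (fun x : ℝ => (x/2)^ν) (1/2 * ν * (j m / 2) ^ (ν - 1)) (j m) :=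
      ((hasDerivAt_id (j m)).div_const 2).rpow_const (Or.inl (by simp; linarith))
    have d2 : HasDerivAt (fun x : ℝ => G (x^2/4)) (G1 (j m ^ 2 / 4) * (j m / 2)) (j m) := by
      have := (hG (j m ^ 2 / 4)).comp (j m) (((hasDerivAt_id (j m)).pow 2).div_const 4)
      refine this.congr_deriv ?_
      simp; left; ring
    have := (d1.mul d2).deriv
    rw [hz m hm] at this
    simpa [Pi.mul_def] using this
  have hG1ne : ∀ m, 1 ≤ m → G1 (j m ^ 2 / 4) ≠ 0 := by
    intro m hm h
    have hi := hI2 (j m ^ 2 / 4)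
    rw [h, hz m hm] at hi
    have c1 : Continuous (fun x : ℝ => x ^ (1 - α)) := Real.continuous_rpow_const (by linarith)
    have c2 : Continuous (fun x : ℝ => x ^ (2 - α)) := Real.continuous_rpow_const (by linarith)
    have hpos : 0 < ∫ x in (0:ℝ)..1, (x ^ (1 - α) * G (j m ^ 2 / 4 * x ^ (2 - α))) *
        (x ^ (1 - α) * G (j m ^ 2 / 4 * x ^ (2 - α))) := by
      refine intervalIntegral.integral_pos one_pos (by fun_prop) (fun x _ => mul_self_nonneg _) ?_
      have cc : Continuous (fun x : ℝ => G (j m ^ 2 / 4 * x ^ (2 - α))) := by fun_prop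
      have ev1 : ∀ᶠ x in nhdsWithin (0:ℝ) (Set.Ioi 0), 0 < G (j m ^ 2 / 4 * x ^ (2 - α)) := by
        refine (cc.continuousAt.eventually (lt_mem_nhds (a := 0) ?_)).filter_mono nhdsWithin_le_nhds
        have : (0:ℝ) ^ (2 - α) = 0 := Real.zero_rpow (by linarith)
        simpa [this] using hGpos
      obtain ⟨x, hx1, hx2⟩ := (ev1.and (Ioo_mem_nhdsGT (one_pos (α := ℝ)))).exists
      refine ⟨x, ⟨hx2.1.le, hx2.2.le⟩, ?_⟩
      have := Real.rpow_pos_of_pos hx2.1 (1 - α)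
      positivity
    have : 0 < (2 - α) * ∫ x in (0:ℝ)..1, (x ^ (1 - α) * G (j m ^ 2 / 4 * x ^ (2 - α))) *
        (x ^ (1 - α) * G (j m ^ 2 / 4 * x ^ (2 - α))) := mul_pos (by linarith) hpos
    rw [hi] at this
    simp at this
  have hu : ∀ a x : ℝ, 0 ≤ a → 0 ≤ x → x ^ ((1 - α) / 2) * besselJ ν (a * x ^ κ) =
      (a/2) ^ ν * (x ^ (1 - α) * G (a ^ 2 / 4 * x ^ (2 - α))) := by
    intro a x ha hx
    have hxk : 0 ≤ x ^ κ := Real.rpow_nonneg hx _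
    rw [hJ _ (by positivity)]
    have e1 : (a * x ^ κ / 2) ^ ν = (a/2)^ν * x ^ ((1 - α)/2) := by
      rw [show a * x ^ κ / 2 = a / 2 * x ^ κ by ring, Real.mul_rpow (by positivity) hxk, ← Real.rpow_mul hx]
      congr 2
      rw [hκ, hν]; field_simp [show (2 - α) ≠ 0 by linarith]
    have e2 : x ^ (1 - α) = x ^ ((1 - α)/2) * x ^ ((1 - α)/2) := by
      rw [← Real.rpow_add_of_nonneg hx (by linarith) (by linarith)]; congr 1; ring
    have e3 : (a * x ^ κ) ^ 2 / 4 = a ^ 2 / 4 * x ^ (2 - α) := by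
      rw [mul_pow, ← Real.rpow_natCast (x ^ κ), ← Real.rpow_mul hx]
      rw [show κ * ((2:ℕ):ℝ) = 2 - α by rw [hκ]; push_cast; ring]; ring
    rw [e1, e2, e3]; ring
  set μ := Real.sqrt (ev n - lam) / κ with hμ
  have hμ0 : 0 ≤ μ := by positivity
  have hμ2 : κ ^ 2 * μ ^ 2 = ev n - lam := by
    rw [hμ, div_pow, Real.sq_sqrt (by linarith)]; field_simp
  have hjn := hjpos n hn
  have hjk := hjpos k hk
  have c1 : Continuous (fun x : ℝ => x ^ (1 - α)) := Real.continuous_rpow_const (by linarith)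
  have c2 : Continuous (fun x : ℝ => x ^ (2 - α)) := Real.continuous_rpow_const (by linarith)
  set I1 := ∫ x in (0:ℝ)..1, (x ^ (1 - α) * G (j n ^ 2 / 4 * x ^ (2 - α))) *
        (x ^ (1 - α) * G (j k ^ 2 / 4 * x ^ (2 - α))) with hI1
  set I2 := ∫ x in (0:ℝ)..1, (x ^ (1 - α) * G (μ ^ 2 / 4 * x ^ (2 - α))) *
        (x ^ (1 - α) * G (j k ^ 2 / 4 * x ^ (2 - α))) with hI2'
  have hS : Real.sqrt (2 * κ) * Real.sqrt (2 * κ) = 2 * κ := Real.mul_self_sqrt (by positivity)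
  have hLHS : ∫ x in (0:ℝ)..1, (φ n x - ξ n x) * φ k x =
      2 * κ / (deriv (besselJ ν) (j n) * deriv (besselJ ν) (j k)) * (j k / 2) ^ ν *
        ((j n / 2) ^ ν * I1 - (μ / 2) ^ ν * I2) := by
    rw [hI1, hI2', ← intervalIntegral.integral_const_mul, ← intervalIntegral.integral_const_mul,
      ← intervalIntegral.integral_sub (Continuous.intervalIntegrable (by fun_prop) _ _)
        (Continuous.intervalIntegrable (by fun_prop) _ _), ← intervalIntegral.integral_const_mul]
    refine intervalIntegral.integral_congr fun x hx => ?_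
    rw [Set.uIcc_of_le zero_le_one] at hx
    simp only [hφ, hξ]
    rw [mul_assoc (Real.sqrt (2 * κ)), mul_assoc (Real.sqrt (2 * κ)), mul_assoc (Real.sqrt (2 * κ)),
      hu _ _ hjn.le hx.1, hu _ _ hjk.le hx.1, ← hμ, hu _ _ hμ0 hx.1]
    generalize Real.sqrt (2 * κ) = S at *
    rw [← hS]
    ring
  have hA1 := hA _ hjn
  have hA2 := hA _ hjk
  have g1 := hG1ne n hn
  have g2 := hG1ne k hk
  have hevk := hev k
  have h2κ : 2 - α = 2 * κ := by rw [hκ]; ring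
  rw [h2κ] at hI hI2
  have hden' : ev k - ev n + lam = κ ^ 2 * (j k ^ 2 - μ ^ 2) := by
    rw [mul_sub, hμ2, hevk]; ring
  have hne : j k ^ 2 - μ ^ 2 ≠ 0 := fun h => hden (by rw [hden', h, mul_zero])
  have r2 : I2 = - (j k ^ 2 * G (μ ^ 2 / 4) * G1 (j k ^ 2 / 4)) / (2 * κ * (j k ^ 2 - μ ^ 2)) := by
    have := hI (μ ^ 2 / 4) (j k ^ 2 / 4)
    rw [hz k hk, ← h2κ, ← hI2', h2κ] at this
    rw [eq_div_iff (by positivity)]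
    linear_combination 4 * this
  have r1 : I1 = if k = n then j n ^ 2 / 4 * G1 (j n ^ 2 / 4) ^ 2 / (2 * κ) else 0 := by
    split_ifs with h
    · subst h
      have := hI2 (j k ^ 2 / 4)
      rw [hz k hk, ← h2κ, ← hI1, h2κ] at this
      rw [eq_div_iff (by positivity)]
      linear_combination this
    · have := hI (j n ^ 2 / 4) (j k ^ 2 / 4)
      rw [hz k hk, hz n hn, ← h2κ, ← hI1, h2κ] at this
      have hjne : j k ^ 2 / 4 - j n ^ 2 / 4 ≠ 0 := by
        intro h'
        have : j k = j n := by
          have := (sq_eq_sq₀ hjk.le hjn.le).1 (by linarith)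
          exact this
        rcases lt_or_gt_of_ne h with h2 | h2
        · exact absurd this (hjmono k n hk h2).ne
        · exact absurd this (hjmono n k hn h2).ne'
      have h3 : 2 * κ * (j k ^ 2 / 4 - j n ^ 2 / 4) ≠ 0 := mul_ne_zero (by positivity) hjne
      have h4 : 2 * κ * (j k ^ 2 / 4 - j n ^ 2 / 4) * I1 = 0 := by rw [this]; ring
      exact (mul_eq_zero.1 h4).resolve_left h3
  rw [hLHS, hD n hn, hD k hk, hJ μ hμ0, hden', r1, r2]
  generalize (μ / 2) ^ ν = M
  generalize G (μ ^ 2 / 4) = Gm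
  split_ifs with h
  · subst h
    generalize (j k / 2) ^ ν = A at *
    generalize G1 (j k ^ 2 / 4) = B at *
    field_simp
    ring
  · generalize (j k / 2) ^ ν = A at *
    generalize G1 (j k ^ 2 / 4) = B at *
    generalize (j n / 2) ^ ν = A' at *
    generalize G1 (j n ^ 2 / 4) = B' at *
    field_simp
    ring
end

section
/- There exists a constant C > 0 such that for all n ≠ k with λ_n > λ, (√λ_n/√λ_k) · | (2 j_{ν,k} κ² / ((λ_k − λ_n + λ) J_ν′(j_{ν,n}))) · J_ν(√(λ_n − λ)/κ) | ≤ C / |k² − n²|. -/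
open MeasureTheory Real Set

lemma ps_summable (a : ℕ → ℝ) (C : ℝ) (ha : ∀ m, |a m| ≤ C / (m.factorial : ℝ)) (t : ℝ) :
    Summable (fun m => a m * t ^ m) := by
  refine Summable.of_norm_bounded (g := fun m => C * (|t| ^ m / (m.factorial : ℝ)))
    ((Real.summable_pow_div_factorial |t|).mul_left C) ?_
  intro m
  rw [Real.norm_eq_abs, abs_mul, abs_pow]
  calc |a m| * |t| ^ m ≤ C / (m.factorial : ℝ) * |t| ^ m := by gcongr; exact ha m
    _ = _ := by ring

lemma ps_bound_succ (a : ℕ → ℝ) (C : ℝ) (ha : ∀ m, |a m| ≤ C / (m.factorial : ℝ)) (m : ℕ) :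
    |((m : ℝ) + 1) * a (m + 1)| ≤ C / (m.factorial : ℝ) := by
  have h := ha (m + 1)
  have hm : (0 : ℝ) < (m : ℝ) + 1 := by positivity
  rw [abs_mul, abs_of_pos hm]
  rw [Nat.factorial_succ] at h
  push_cast at h
  calc ((m : ℝ) + 1) * |a (m + 1)| ≤ ((m : ℝ) + 1) * (C / (((m : ℝ) + 1) * (m.factorial : ℝ))) := by
        gcongr
    _ = _ := by field_simp

lemma ps_hasDerivAt (a : ℕ → ℝ) (C : ℝ) (ha : ∀ m, |a m| ≤ C / (m.factorial : ℝ)) (t : ℝ) :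
    HasDerivAt (fun t => ∑' m, a m * t ^ m) (∑' m : ℕ, (((m : ℝ) + 1) * a (m + 1)) * t ^ m) t := by
  have hC : 0 ≤ C := by
    have := (abs_nonneg _).trans (ha 0)
    simpa using this
  set R := |t| + 1 with hR
  have hR0 : 0 < R := by positivity
  have hs : Summable (fun m : ℕ => |a m| * m * R ^ (m - 1)) := by
    rw [← summable_nat_add_iff 1]
    have := (ps_summable (fun m => |((m : ℝ) + 1) * a (m + 1)|) C
      (fun m => by rw [abs_abs]; exact ps_bound_succ a C ha m) R)
    refine this.congr ?_
    intro m
    rw [abs_mul, abs_of_pos (by positivity : (0 : ℝ) < (m : ℝ) + 1)]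
    push_cast
    ring
  have key := hasDerivAt_tsum_of_isPreconnected (g := fun (m : ℕ) (t : ℝ) => a m * t ^ m)
    (g' := fun (m : ℕ) (t : ℝ) => a m * ((m : ℝ) * t ^ (m - 1))) hs
    (t := Metric.ball (0 : ℝ) R) (y₀ := 0) (y := t) Metric.isOpen_ball
    (convex_ball (0 : ℝ) R).isPreconnected
    (fun m y _ => (hasDerivAt_pow m y).const_mul (a m))
    (fun m y hy => by
      rw [mem_ball_zero_iff, Real.norm_eq_abs] at hy
      rw [Real.norm_eq_abs, abs_mul, abs_mul, abs_pow, Nat.abs_cast, ← mul_assoc]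
      gcongr)
    (by simpa using hR0) (ps_summable a C ha 0)
    (by rw [mem_ball_zero_iff, Real.norm_eq_abs]; linarith)
  refine HasDerivAt.congr_deriv key (Eq.symm ?_)
  have hs' : Summable (fun m : ℕ => a m * ((m : ℝ) * t ^ (m - 1))) := by
    refine Summable.of_norm_bounded hs ?_
    intro m
    rw [Real.norm_eq_abs, abs_mul, abs_mul, abs_pow, Nat.abs_cast, ← mul_assoc]
    gcongr
    linarith
  rw [hs'.tsum_eq_zero_add]
  simp only [Nat.cast_zero, zero_mul, mul_zero, zero_add]
  refine tsum_congr fun m => ?_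
  push_cast
  ring

noncomputable def bcoef (ν : ℝ) (m : ℕ) : ℝ :=
  (-1 : ℝ) ^ m / ((m.factorial : ℝ) * Real.Gamma ((m : ℝ) + ν + 1))

lemma gamma_lb (ν : ℝ) (hν : 0 < ν) (m : ℕ) :
    Real.Gamma (ν + 1) ≤ Real.Gamma ((m : ℝ) + ν + 1) := by
  induction m with
  | zero => simp
  | succ m ih =>
    have h : ((m + 1 : ℕ) : ℝ) + ν + 1 = ((m : ℝ) + ν + 1) + 1 := by push_cast; ring
    have h0 : (0 : ℝ) < (m : ℝ) + ν + 1 := by positivity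
    rw [h, Real.Gamma_add_one h0.ne']
    have := Real.Gamma_pos_of_pos h0
    have hm : (0 : ℝ) ≤ m := by positivity
    nlinarith

lemma bcoef_bound (ν : ℝ) (hν : 0 < ν) (m : ℕ) :
    |bcoef ν m| ≤ (1 / Real.Gamma (ν + 1)) / (m.factorial : ℝ) := by
  have h1 := gamma_lb ν hν m
  have h2 : 0 < Real.Gamma (ν + 1) := Real.Gamma_pos_of_pos (by linarith)
  have hf : (0 : ℝ) < m.factorial := by positivity
  unfold bcoef
  rw [abs_div, abs_pow, abs_neg, abs_one, one_pow, abs_of_pos (by nlinarith [mul_pos hf (h2.trans_le h1)]),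
    div_div, mul_comm]
  gcongr

lemma bcoef_rec (ν : ℝ) (hν : 0 < ν) (m : ℕ) :
    bcoef ν (m + 1) * (m + 1) * (m + ν + 1) = - bcoef ν m := by
  have h : ((m + 1 : ℕ) : ℝ) + ν + 1 = ((m : ℝ) + ν + 1) + 1 := by push_cast; ring
  have h0 : (0 : ℝ) < (m : ℝ) + ν + 1 := by positivity
  have hg := (Real.Gamma_pos_of_pos h0).ne'
  have hf : (m.factorial : ℝ) ≠ 0 := by positivity
  have hm : (m : ℝ) + 1 ≠ 0 := by positivity
  unfold bcoef
  rw [h, Real.Gamma_add_one h0.ne', Nat.factorial_succ, pow_succ]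
  have := h0.ne'
  push_cast
  field_simp

/-- ODE for the even part. -/
lemma exists_h (ν : ℝ) (hν : 0 < ν) : ∃ h h1 : ℝ → ℝ,
    (∀ x, HasDerivAt h (h1 x) x) ∧
    (∀ x, 0 < x → HasDerivAt h1 (-(2 * ν + 1) / x * h1 x - h x) x) ∧
    (∀ x, 0 < x → besselJ ν x = (x / 2) ^ ν * h x) := by
  set C := 1 / Real.Gamma (ν + 1)
  let a0 := bcoef ν
  let a1 : ℕ → ℝ := fun m => ((m : ℝ) + 1) * a0 (m + 1)
  let a2 : ℕ → ℝ := fun m => ((m : ℝ) + 1) * a1 (m + 1)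
  have b0 : ∀ m, |a0 m| ≤ C / (m.factorial : ℝ) := bcoef_bound ν hν
  have b1 : ∀ m, |a1 m| ≤ C / (m.factorial : ℝ) := ps_bound_succ a0 C b0
  have b2 : ∀ m, |a2 m| ≤ C / (m.factorial : ℝ) := ps_bound_succ a1 C b1
  let g0 : ℝ → ℝ := fun t => ∑' m, a0 m * t ^ m
  let g1 : ℝ → ℝ := fun t => ∑' m, a1 m * t ^ m
  let g2 : ℝ → ℝ := fun t => ∑' m, a2 m * t ^ m
  have d0 : ∀ t, HasDerivAt g0 (g1 t) t := ps_hasDerivAt a0 C b0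
  have d1 : ∀ t, HasDerivAt g1 (g2 t) t := ps_hasDerivAt a1 C b1
  have ode : ∀ t, t * g2 t + (ν + 1) * g1 t + g0 t = 0 := by
    intro t
    have s0 := ps_summable a0 C b0 t
    have s1 := ps_summable a1 C b1 t
    have s2 := ps_summable a2 C b2 t
    have e2 : t * g2 t = ∑' m : ℕ, (m : ℝ) * a1 m * t ^ m := by
      have s3 : Summable (fun m : ℕ => (m : ℝ) * a1 m * t ^ m) := by
        rw [← summable_nat_add_iff 1]
        refine (s2.mul_left t).congr fun m => ?_
        simp only [a2]; push_cast; ring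
      rw [s3.tsum_eq_zero_add]
      simp only [g2, Nat.cast_zero, zero_mul, zero_add]
      rw [← tsum_mul_left]
      refine tsum_congr fun m => ?_
      simp only [a2]; push_cast; ring
    have e0 : g0 t = ∑' m : ℕ, -((m : ℝ) * a1 m * t ^ m + (ν + 1) * (a1 m * t ^ m)) := by
      refine tsum_congr fun m => ?_
      have := bcoef_rec ν hν m
      simp only [a1, a0]
      linear_combination (t ^ m) * this
    have s3 : Summable (fun m : ℕ => (m : ℝ) * a1 m * t ^ m) := by
      rw [← summable_nat_add_iff 1]
      refine (s2.mul_left t).congr fun m => ?_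
      simp only [a2]; push_cast; ring
    rw [e0, tsum_neg, s3.tsum_add (s1.mul_left _), tsum_mul_left, e2]
    simp only [g1]
    ring
  have dq : ∀ x : ℝ, HasDerivAt (fun x : ℝ => x ^ 2 / 4) (x / 2) x := by
    intro x
    refine HasDerivAt.congr_deriv ((hasDerivAt_pow 2 x).div_const 4) (Eq.symm ?_)
    push_cast; ring
  refine ⟨fun x => g0 (x ^ 2 / 4), fun x => g1 (x ^ 2 / 4) * (x / 2), ?_, ?_, ?_⟩
  · intro x
    exact (d0 (x ^ 2 / 4)).comp x (dq x)
  · intro x hx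
    have := ((d1 (x ^ 2 / 4)).comp x (dq x)).mul ((hasDerivAt_id x).div_const 2)
    refine HasDerivAt.congr_deriv this (Eq.symm ?_)
    have o := ode (x ^ 2 / 4)
    simp only [Function.comp, id]
    field_simp
    linear_combination (-4) * o
  · intro x hx
    unfold besselJ
    simp only [g0]
    rw [← tsum_mul_left]
    refine tsum_congr fun m => ?_
    have hx2 : 0 < x / 2 := by positivity
    rw [Real.rpow_add hx2, Real.rpow_mul hx2.le, Real.rpow_natCast]
    have : (x / 2) ^ (2 : ℝ) = x ^ 2 / 4 := by
      rw [Real.rpow_two]; ring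
    rw [this]
    simp only [a0, bcoef]
    ring

lemma bessel_lip (ν : ℝ) (hν : 0 < ν) (hν2 : ν < 1 / 2) :
    ∃ M : ℝ, 0 ≤ M ∧ ∀ x y, 1 ≤ x → x ≤ y →
      |√x * besselJ ν x - √y * besselJ ν y| ≤ M * (y - x) := by
  obtain ⟨h, h1, dh, dh1, hJ⟩ := exists_h ν hν
  set s := ν + 1 / 2 with hs
  let w : ℝ → ℝ := fun x => x ^ s * h x
  let v : ℝ → ℝ := fun x => s * x ^ (s - 1) * h x + x ^ s * h1 x
  have dw : ∀ x, 0 < x → HasDerivAt w (v x) x := by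
    intro x hx
    exact (Real.hasDerivAt_rpow_const (Or.inl hx.ne')).mul (dh x)
  have dv : ∀ x, 0 < x → HasDerivAt v ((s * (s - 1) / x ^ 2 - 1) * w x) x := by
    intro x hx
    have e1 : HasDerivAt (fun x : ℝ => s * x ^ (s - 1)) (s * ((s - 1) * x ^ (s - 1 - 1))) x :=
      (Real.hasDerivAt_rpow_const (Or.inl hx.ne')).const_mul s
    have e2 : HasDerivAt (fun x : ℝ => x ^ s) (s * x ^ (s - 1)) x :=
      (Real.hasDerivAt_rpow_const (Or.inl hx.ne'))
    refine HasDerivAt.congr_deriv ((e1.mul (dh x)).add (e2.mul (dh1 x hx))) (Eq.symm ?_)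
    have p1 : x ^ (s - 1) = x ^ s / x := Real.rpow_sub_one hx.ne' s
    have p2 : x ^ (s - 1 - 1) = x ^ s / x / x := by
      rw [Real.rpow_sub_one hx.ne', Real.rpow_sub_one hx.ne']
    simp only [w]
    rw [p2, p1]
    have : 2 * ν + 1 = 2 * s := by rw [hs]; ring
    rw [this]
    field_simp
    ring
  set μ := - (s * (s - 1)) with hμ
  have hμ0 : 0 ≤ μ := by rw [hμ, hs]; nlinarith
  let E : ℝ → ℝ := fun x => v x ^ 2 + (1 + μ / x ^ 2) * w x ^ 2
  have dE : ∀ x, 0 < x → HasDerivAt E (-(2 * μ / x ^ 3) * w x ^ 2) x := by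
    intro x hx
    have e1 := (dv x hx).pow 2
    have e2 := (dw x hx).pow 2
    have e3 : HasDerivAt (fun x : ℝ => 1 + μ / x ^ 2) (-(2 * μ / x ^ 3)) x := by
      have := ((hasDerivAt_const x μ).div (hasDerivAt_pow 2 x) (by positivity)).const_add 1
      refine HasDerivAt.congr_deriv this (Eq.symm ?_)
      field_simp
      push_cast
      ring
    refine HasDerivAt.congr_deriv (e1.add (e3.mul e2)) (Eq.symm ?_)
    have : s * (s - 1) = - μ := by rw [hμ]; ring
    rw [this]
    simp
    field_simp
    ring
  have anti : AntitoneOn E (Ici 1) := by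
    refine antitoneOn_of_deriv_nonpos (convex_Ici 1) ?_ ?_ ?_
    · intro x hx
      exact (dE x (by have : (1:ℝ) ≤ x := hx; linarith)).continuousAt.continuousWithinAt
    · intro x hx
      rw [interior_Ici] at hx
      exact (dE x (by have : (1:ℝ) < x := hx; linarith)).differentiableAt.differentiableWithinAt
    · intro x hx
      rw [interior_Ici] at hx
      have hx0 : 0 < x := by have : (1:ℝ) < x := hx; linarith
      rw [(dE x hx0).deriv]
      have : 0 ≤ (2 * μ / x ^ 3) * w x ^ 2 := by positivity
      linarith
  have hv : ∀ x, 1 ≤ x → |v x| ≤ √(E 1) := by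
    intro x hx
    apply Real.abs_le_sqrt
    have h1 : E x ≤ E 1 := anti (mem_Ici.2 le_rfl) (mem_Ici.2 hx) hx
    have h2 : 0 ≤ (1 + μ / x ^ 2) * w x ^ 2 := by positivity
    have h3 : E x = v x ^ 2 + (1 + μ / x ^ 2) * w x ^ 2 := rfl
    linarith
  have hc : (0 : ℝ) < (2 : ℝ) ^ ν := by positivity
  have hw : ∀ x, 1 ≤ x → √x * besselJ ν x = w x / 2 ^ ν := by
    intro x hx
    have hx0 : 0 < x := by linarith
    rw [hJ x hx0, Real.div_rpow hx0.le (by norm_num), Real.sqrt_eq_rpow]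
    simp only [w]
    rw [hs, Real.rpow_add hx0]
    ring
  refine ⟨√(E 1) / 2 ^ ν, by positivity, ?_⟩
  intro x y hx hxy
  rw [hw x hx, hw y (hx.trans hxy), ← sub_div, abs_div, abs_of_pos hc, div_mul_eq_mul_div]
  gcongr
  have := Convex.norm_image_sub_le_of_norm_hasDerivWithin_le (f := w) (f' := v) (s := Ici 1)
    (C := √(E 1)) (x := y) (y := x)
    (fun z hz => (dw z (by have : (1:ℝ) ≤ z := hz; linarith)).hasDerivWithinAt)
    (fun z hz => hv z hz) (convex_Ici 1) (mem_Ici.2 (hx.trans hxy)) (mem_Ici.2 hx)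
  rw [Real.norm_eq_abs, Real.norm_eq_abs, abs_sub_comm x y, abs_of_nonneg (by linarith : 0 ≤ y - x)] at this
  exact this

lemma fin_upper (f : ℕ → ℝ) (N : ℕ) : ∃ B : ℝ, 0 ≤ B ∧ ∀ n < N, f n ≤ B := by
  refine ⟨∑ i ∈ Finset.range N, |f i|, Finset.sum_nonneg fun _ _ => abs_nonneg _, ?_⟩
  intro n hn
  exact (le_abs_self _).trans
    (Finset.single_le_sum (f := fun i => |f i|) (fun _ _ => abs_nonneg _) (Finset.mem_range.2 hn))

lemma fin_lower (f : ℕ → ℝ) (hf : ∀ n, 1 ≤ n → 0 < f n) (N : ℕ) :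
    ∃ c : ℝ, 0 < c ∧ ∀ n < N, 1 ≤ n → c ≤ f n := by
  induction N with
  | zero => exact ⟨1, one_pos, fun n hn => absurd hn (Nat.not_lt_zero _)⟩
  | succ N ih =>
    obtain ⟨c, hc, h⟩ := ih
    by_cases hN : 1 ≤ N
    · refine ⟨min c (f N), lt_min hc (hf N hN), ?_⟩
      intro n hn h1
      rcases Nat.lt_succ_iff_lt_or_eq.1 hn with h2 | h2
      · exact (min_le_left _ _).trans (h n h2 h1)
      · rw [h2]; exact min_le_right _ _
    · exact ⟨c, hc, fun n hn h1 => by omega⟩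

lemma gap (ν : ℝ) (j : ℕ → ℝ) (hjpos : ∀ n, 1 ≤ n → 0 < j n)
    (hjmono : ∀ m n, 1 ≤ m → m < n → j m < j n)
    (hasym : ∃ C : ℝ, ∀ n : ℕ, 1 ≤ n →
      |j n - Real.pi * ((n : ℝ) + ν / 2 - 1 / 4)| ≤ C / (n : ℝ)) :
    ∃ c > (0:ℝ), ∀ n k : ℕ, 1 ≤ n → n < k →
      c * ((k : ℝ) ^ 2 - (n : ℝ) ^ 2) ≤ j k ^ 2 - j n ^ 2 := by
  obtain ⟨C, hC⟩ := hasym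
  obtain ⟨N, hN⟩ := exists_nat_ge (2 * |C| + 1)
  obtain ⟨c0, hc0, h0⟩ := fin_lower (fun n => j (n + 1) - j n)
    (fun n hn => sub_pos.2 (hjmono n (n + 1) hn (Nat.lt_succ_self n))) N
  set c := min (min c0 1) (j 1) with hc
  have hcpos : 0 < c := lt_min (lt_min hc0 one_pos) (hjpos 1 le_rfl)
  have hstep : ∀ n, 1 ≤ n → c ≤ j (n + 1) - j n := by
    intro n hn
    by_cases hnN : n < N
    · exact ((min_le_left _ _).trans (min_le_left _ _)).trans (h0 n hnN hn)
    · have hnr : 2 * |C| + 1 ≤ (n : ℝ) := hN.trans (by exact_mod_cast not_lt.1 hnN)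
      have a0 : 0 ≤ |C| := abs_nonneg C
      have hn0 : (0 : ℝ) < n := by linarith
      have b1 : C / (n : ℝ) ≤ 1 / 2 := by
        rw [div_le_iff₀ hn0]; linarith [le_abs_self C]
      have b2 : C / ((n + 1 : ℕ) : ℝ) ≤ 1 / 2 := by
        push_cast
        rw [div_le_iff₀ (by linarith)]; linarith [le_abs_self C]
      have e1 := abs_le.1 ((hC n hn).trans b1)
      have e2 := abs_le.1 ((hC (n + 1) (by omega)).trans b2)
      push_cast at e2
      have : c ≤ 1 := (min_le_left _ _).trans (min_le_right _ _)
      have hp := Real.pi_gt_three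
      nlinarith [e1.1, e1.2, e2.1, e2.2]
  have hdiff : ∀ n, 1 ≤ n → ∀ d : ℕ, c * d ≤ j (n + d) - j n := by
    intro n hn d
    induction d with
    | zero => simp
    | succ d ih =>
      have := hstep (n + d) (by omega)
      push_cast
      rw [← add_assoc]
      linarith
  have hlow : ∀ n, 1 ≤ n → c * n ≤ j n := by
    intro n hn
    have := hdiff 1 le_rfl (n - 1)
    rw [Nat.cast_sub hn, Nat.add_sub_cancel' hn] at this
    have h1 : c ≤ j 1 := min_le_right _ _
    push_cast at this
    linarith
  refine ⟨c ^ 2, by positivity, ?_⟩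
  intro n k hn hk
  have h1 := hdiff n hn (k - n)
  rw [Nat.cast_sub hk.le, Nat.add_sub_cancel' hk.le] at h1
  have h2 := hlow n hn
  have h3 := hlow k (by omega)
  have hkn : (n : ℝ) < k := by exact_mod_cast hk
  have hn0 : (0 : ℝ) ≤ n := by positivity
  calc c ^ 2 * ((k : ℝ) ^ 2 - (n : ℝ) ^ 2) = (c * (k - n)) * (c * k + c * n) := by ring
    _ ≤ (j k - j n) * (j k + j n) := by
      apply mul_le_mul h1 (by linarith) (by positivity)
      have : 0 ≤ c * ((k : ℝ) - n) := mul_nonneg hcpos.le (by linarith)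
      linarith
    _ = _ := by ring

lemma den_bound (ν κ : ℝ) (hκ : 0 < κ) (j : ℕ → ℝ) (hjpos : ∀ n, 1 ≤ n → 0 < j n)
    (hjmono : ∀ m n, 1 ≤ m → m < n → j m < j n)
    (hasym : ∃ C : ℝ, ∀ n : ℕ, 1 ≤ n →
      |j n - Real.pi * ((n : ℝ) + ν / 2 - 1 / 4)| ≤ C / (n : ℝ))
    (ev : ℕ → ℝ) (hev : ∀ n, ev n = (κ * j n) ^ 2)
    (lam : ℝ) (hlam : 0 < lam) :
    ∃ D : ℝ, 0 ≤ D ∧ ∀ n k : ℕ, 1 ≤ n → 1 ≤ k → n ≠ k →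
      |(k : ℝ) ^ 2 - (n : ℝ) ^ 2| * |ev k - ev n + lam|⁻¹ ≤ D := by
  obtain ⟨c, hc, hg⟩ := gap ν j hjpos hjmono hasym
  set d := κ ^ 2 * c with hd
  have hdpos : 0 < d := by positivity
  have hg' : ∀ n k : ℕ, 1 ≤ n → 1 ≤ k → n ≠ k →
      d * |(k : ℝ) ^ 2 - (n : ℝ) ^ 2| ≤ |ev k - ev n| := by
    have aux : ∀ n k : ℕ, 1 ≤ n → n < k →
        d * |(k : ℝ) ^ 2 - (n : ℝ) ^ 2| ≤ |ev k - ev n| := by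
      intro n k hn hk
      have h := hg n k hn hk
      have hkn : (n : ℝ) < k := by exact_mod_cast hk
      have hn0 : (0 : ℝ) ≤ n := by positivity
      rw [abs_of_nonneg (by nlinarith : (0 : ℝ) ≤ (k : ℝ) ^ 2 - (n : ℝ) ^ 2)]
      refine le_trans ?_ (le_abs_self _)
      rw [hev, hev]
      calc d * ((k : ℝ) ^ 2 - (n : ℝ) ^ 2) = κ ^ 2 * (c * ((k : ℝ) ^ 2 - (n : ℝ) ^ 2)) := by
            rw [hd]; ring
        _ ≤ κ ^ 2 * (j k ^ 2 - j n ^ 2) := by gcongr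
        _ = _ := by ring
    intro n k hn hk hnk
    rcases lt_or_gt_of_ne hnk with h | h
    · exact aux n k hn h
    · rw [abs_sub_comm, abs_sub_comm (ev k)]; exact aux k n hk h
  have hsum : ∀ n k : ℕ, n ≠ k → (n : ℝ) + k ≤ |(k : ℝ) ^ 2 - (n : ℝ) ^ 2| := by
    intro n k hnk
    have h1 : (1 : ℝ) ≤ |(k : ℝ) - n| := by
      have : (1 : ℤ) ≤ |(k : ℤ) - n| := Int.one_le_abs (by omega)
      exact_mod_cast this
    have h2 : (k : ℝ) ^ 2 - (n : ℝ) ^ 2 = (k - n) * (n + k) := by ring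
    rw [h2, abs_mul, abs_of_nonneg (by positivity : (0 : ℝ) ≤ (n : ℝ) + k)]
    have : (0 : ℝ) ≤ (n : ℝ) + k := by positivity
    nlinarith
  obtain ⟨N, hN⟩ := exists_nat_gt (2 * lam / d)
  set F : ℕ × ℕ → ℝ := fun p =>
    |(p.2 : ℝ) ^ 2 - (p.1 : ℝ) ^ 2| * |ev p.2 - ev p.1 + lam|⁻¹ with hF
  have hF0 : ∀ p, 0 ≤ F p := fun p => by simp only [hF]; positivity
  set S := ∑ p ∈ Finset.range N ×ˢ Finset.range N, F p with hS
  have hS0 : 0 ≤ S := Finset.sum_nonneg fun p _ => hF0 p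
  refine ⟨S + 2 / d, by positivity, ?_⟩
  intro n k hn hk hnk
  have hx := hsum n k hnk
  have hy := hg' n k hn hk hnk
  set X := |(k : ℝ) ^ 2 - (n : ℝ) ^ 2| with hX
  by_cases hbig : 2 * lam ≤ d * X
  · have h1 : d * X / 2 ≤ |ev k - ev n + lam| := by
      have := abs_sub_abs_le_abs_sub (ev k - ev n) (-lam)
      rw [abs_neg, abs_of_pos hlam, sub_neg_eq_add] at this
      linarith
    have hXpos : 0 < X := by
      by_contra hneg
      nlinarith
    have h2 : X * |ev k - ev n + lam|⁻¹ ≤ 2 / d := by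
      rw [← div_eq_mul_inv, div_le_div_iff₀ (lt_of_lt_of_le (by positivity) h1) hdpos]
      linarith
    linarith
  · have hXN : X < N := by
      have : X < 2 * lam / d := by rw [lt_div_iff₀ hdpos]; linarith
      linarith
    have hnN : n < N := by
      have : (n : ℝ) < N := by
        have : (0 : ℝ) ≤ k := by positivity
        linarith
      exact_mod_cast this
    have hkN : k < N := by
      have : (k : ℝ) < N := by
        have : (0 : ℝ) ≤ n := by positivity
        linarith
      exact_mod_cast this
    have : F (n, k) ≤ S := Finset.single_le_sum (f := F) (fun p _ => hF0 p)
      (Finset.mem_product.2 ⟨Finset.mem_range.2 hnN, Finset.mem_range.2 hkN⟩)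
    have h2 : 0 ≤ 2 / d := by positivity
    have h3 : F (n, k) = X * |ev k - ev n + lam|⁻¹ := rfl
    linarith

lemma num_bound (ν κ : ℝ) (hν : 0 < ν) (hν2 : ν < 1 / 2) (hκ : 0 < κ)
    (j : ℕ → ℝ) (hjpos : ∀ n, 1 ≤ n → 0 < j n)
    (hjzero : ∀ n, 1 ≤ n → besselJ ν (j n) = 0)
    (hjtop : Filter.Tendsto j Filter.atTop Filter.atTop)
    (hder : ∃ c₁ > (0:ℝ), ∀ n, 1 ≤ n →
      c₁ / Real.sqrt (j n) ≤ |deriv (besselJ ν) (j n)|)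
    (ev : ℕ → ℝ) (hev : ∀ n, ev n = (κ * j n) ^ 2)
    (lam : ℝ) (hlam : 0 < lam) :
    ∃ B : ℝ, 0 ≤ B ∧ ∀ n : ℕ, 1 ≤ n →
      j n * |besselJ ν (Real.sqrt (ev n - lam) / κ)| * |deriv (besselJ ν) (j n)|⁻¹ ≤ B := by
  obtain ⟨M, hM0, hM⟩ := bessel_lip ν hν hν2
  obtain ⟨c, hc, hder⟩ := hder
  set q := lam / κ ^ 2 with hq
  have hq0 : 0 < q := by positivity
  obtain ⟨N, hN⟩ := Filter.eventually_atTop.1 (hjtop.eventually_ge_atTop (2 + 2 * q))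
  obtain ⟨B0, hB0, hB⟩ := fin_upper (fun n =>
    j n * |besselJ ν (Real.sqrt (ev n - lam) / κ)| * |deriv (besselJ ν) (j n)|⁻¹) N
  refine ⟨B0 + 2 * M * q / c, by positivity, ?_⟩
  intro n hn
  by_cases hnN : n < N
  · have := hB n hnN
    have h2 : 0 ≤ 2 * M * q / c := by positivity
    linarith
  · have hj := hN n (not_lt.1 hnN)
    have hjp := hjpos n hn
    set y := j n with hy
    set x := Real.sqrt (ev n - lam) / κ with hx
    have hx2 : x ^ 2 = y ^ 2 - q := by
      rw [hx, div_pow, Real.sq_sqrt, hev, hq]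
      · rw [← hy]; field_simp
      · rw [hev]
        have : lam = κ ^ 2 * q := by rw [hq]; field_simp
        rw [this, mul_pow, ← hy]
        have : 0 ≤ κ ^ 2 * (y ^ 2 - q) := by
          apply mul_nonneg (by positivity); nlinarith
        linarith
    have hx0 : 0 ≤ x := by positivity
    have hxy : x ≤ y := by
      apply le_of_sq_le_sq _ hjp.le
      linarith
    have hxhalf : y / 2 ≤ x := by
      apply le_of_sq_le_sq _ hx0
      nlinarith
    have hx1 : 1 ≤ x := by linarith
    have hl := hM x y hx1 hxy
    rw [hjzero n hn, mul_zero, sub_zero, abs_mul, abs_of_nonneg (Real.sqrt_nonneg x)] at hl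
    have hd : y * (y - x) ≤ q := by nlinarith
    have hs : √y ≤ 2 * √x := by
      apply le_of_sq_le_sq _ (by positivity)
      rw [mul_pow, Real.sq_sqrt hjp.le, Real.sq_sqrt hx0]
      linarith
    have hsy : 0 < √y := Real.sqrt_pos.2 hjp
    have hdr := hder n hn
    have hinv : |deriv (besselJ ν) y|⁻¹ ≤ √y / c := by
      rw [← inv_div]
      exact inv_anti₀ (by positivity) hdr
    have hJ : √y * |besselJ ν x| ≤ 2 * (M * (y - x)) := by
      have := mul_le_mul_of_nonneg_right hs (abs_nonneg (besselJ ν x))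
      linarith
    calc y * |besselJ ν x| * |deriv (besselJ ν) y|⁻¹ ≤ y * |besselJ ν x| * (√y / c) := by gcongr
      _ = y * (√y * |besselJ ν x|) / c := by ring
      _ ≤ y * (2 * (M * (y - x))) / c := by gcongr
      _ = 2 * M * (y * (y - x)) / c := by ring
      _ ≤ 2 * M * q / c := by gcongr
      _ ≤ _ := by linarith



/-- There exists `C > 0` such that for all `n ≠ k` (both `≥ 1`) with `λ_n > λ`,
`(√λ_n/√λ_k) |(2 j_{ν,k} κ² / ((λ_k - λ_n + λ) J_ν'(j_{ν,n}))) J_ν(√(λ_n - λ)/κ)| ≤ C/|k² - n²|`. -/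
theorem stmt_12 (α ν κ : ℝ) (hα : α ∈ Set.Ioo (0:ℝ) 1)
    (hν : ν = (1 - α) / (2 - α)) (hκ : κ = (2 - α) / 2)
    (j : ℕ → ℝ)
    (hjpos : ∀ n, 1 ≤ n → 0 < j n)
    (hjmono : ∀ m n, 1 ≤ m → m < n → j m < j n)
    (hjzero : ∀ n, 1 ≤ n → besselJ ν (j n) = 0)
    (hjtop : Filter.Tendsto j Filter.atTop Filter.atTop)
    (hasym : ∃ C : ℝ, ∀ n : ℕ, 1 ≤ n →
      |j n - Real.pi * ((n : ℝ) + ν / 2 - 1 / 4)| ≤ C / (n : ℝ))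
    (hder : ∃ c₁ > (0:ℝ), ∃ c₂ > (0:ℝ), ∀ n, 1 ≤ n →
      c₁ / Real.sqrt (j n) ≤ |deriv (besselJ ν) (j n)| ∧
      |deriv (besselJ ν) (j n)| ≤ c₂ / Real.sqrt (j n))
    (ev : ℕ → ℝ) (hev : ∀ n, ev n = (κ * j n) ^ 2)
    (lam : ℝ) (hlam : 0 < lam)
    (hnr1 : ∀ n, 1 ≤ n → lam ≠ ev n)
    (hnr2 : ∀ n k, 1 ≤ n → 1 ≤ k → lam - ev n ≠ ev k) :
    ∃ C > (0:ℝ), ∀ n k : ℕ, 1 ≤ n → 1 ≤ k → n ≠ k → lam < ev n →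
      Real.sqrt (ev n) / Real.sqrt (ev k) *
        |(2 * j k * κ ^ 2 / ((ev k - ev n + lam) * deriv (besselJ ν) (j n))) *
          besselJ ν (Real.sqrt (ev n - lam) / κ)| ≤
        C / |(k : ℝ) ^ 2 - (n : ℝ) ^ 2| := by
  obtain ⟨hα0, hα1⟩ := hα
  have hν0 : 0 < ν := by rw [hν]; apply div_pos <;> linarith
  have hν2 : ν < 1 / 2 := by
    rw [hν, div_lt_iff₀ (by linarith)]; linarith
  have hκ0 : 0 < κ := by rw [hκ]; linarith
  obtain ⟨D, hD0, hD⟩ := den_bound ν κ hκ0 j hjpos hjmono hasym ev hev lam hlam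
  obtain ⟨c₁, hc₁, c₂, hc₂, hd⟩ := hder
  obtain ⟨B, hB0, hB⟩ := num_bound ν κ hν0 hν2 hκ0 j hjpos hjzero hjtop
    ⟨c₁, hc₁, fun n hn => (hd n hn).1⟩ ev hev lam hlam
  refine ⟨2 * κ ^ 2 * B * D + 1, by positivity, ?_⟩
  intro n k hn hk hnk _
  have hX : 0 < |(k : ℝ) ^ 2 - (n : ℝ) ^ 2| := by
    rw [abs_pos, sub_ne_zero]
    intro h
    apply hnk
    have : k ^ 2 = n ^ 2 := by exact_mod_cast h
    exact (Nat.pow_left_injective (by norm_num : (2:ℕ) ≠ 0) this).symm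
  have hjn := hjpos n hn
  have hjk := hjpos k hk
  rw [le_div_iff₀ hX]
  have sn : Real.sqrt (ev n) = κ * j n := by rw [hev]; exact Real.sqrt_sq (by positivity)
  have sk : Real.sqrt (ev k) = κ * j k := by rw [hev]; exact Real.sqrt_sq (by positivity)
  rw [sn, sk, abs_mul, abs_div, abs_mul (ev k - ev n + lam), abs_of_pos (by positivity : 0 < 2 * j k * κ ^ 2)]
  set J := |besselJ ν (Real.sqrt (ev n - lam) / κ)|
  set d := |deriv (besselJ ν) (j n)|
  set e := |ev k - ev n + lam|
  set X := |(k : ℝ) ^ 2 - (n : ℝ) ^ 2|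
  have key : κ * j n / (κ * j k) * (2 * j k * κ ^ 2 / (e * d) * J) * X
      = 2 * κ ^ 2 * (j n * J * d⁻¹) * (X * e⁻¹) := by
    rw [div_eq_mul_inv _ (e * d), mul_inv]
    field_simp
  rw [key]
  have h1 := hB n hn
  have h2 := hD n k hn hk hnk
  calc 2 * κ ^ 2 * (j n * J * d⁻¹) * (X * e⁻¹) ≤ 2 * κ ^ 2 * B * D := by
        gcongr
    _ ≤ _ := by linarith
end

section
/- The double series Σ_{n : λ_n > λ} Σ_{k ≥ 1} (λ_n/λ_k) ( ∫₀¹ (φ_n(x) − ξ̃_n(x)) φ_k(x) dx )² converges (is finite). (This expresses that {√λ_n ξ̃_n} is quadratically close to the orthonormal family {√λ_n φ_n} in the dual space D(A^{1/2})′.) -/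
open MeasureTheory Real Set

/-- Coefficients of the entire part of the Bessel function. -/
noncomputable def cf (ν : ℝ) (m : ℕ) : ℝ :=
  (-1 : ℝ) ^ m / ((m.factorial : ℝ) * Real.Gamma ((m : ℝ) + ν + 1))

/-- Entire part of the Bessel function. -/
noncomputable def FF (ν t : ℝ) : ℝ := ∑' m : ℕ, cf ν m * t ^ m

lemma cf_gamma_ge {ν : ℝ} (hν : 0 ≤ ν) (m : ℕ) :
    Real.Gamma (ν + 1) ≤ Real.Gamma ((m : ℝ) + ν + 1) := by
  induction m with
  | zero => simp
  | succ k ih =>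
    have hk : (0:ℝ) ≤ k := Nat.cast_nonneg k
    have h1 : Real.Gamma (((k + 1 : ℕ) : ℝ) + ν + 1)
        = ((k:ℝ) + ν + 1) * Real.Gamma ((k:ℝ) + ν + 1) := by
      rw [← Real.Gamma_add_one (by positivity)]
      congr 1
      push_cast; ring
    rw [h1]
    have hp : 0 < Real.Gamma ((k:ℝ) + ν + 1) := Real.Gamma_pos_of_pos (by positivity)
    nlinarith

lemma cf_bound {ν : ℝ} (hν : 0 ≤ ν) (m : ℕ) :
    |cf ν m| ≤ (1 / Real.Gamma (ν + 1)) * (1 / (m.factorial : ℝ)) := by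
  have hp : 0 < Real.Gamma (ν + 1) := Real.Gamma_pos_of_pos (by positivity)
  have hp' := hp.trans_le (cf_gamma_ge hν m)
  have hf : (0:ℝ) < m.factorial := by positivity
  unfold cf
  rw [abs_div, abs_pow, abs_neg, abs_one, one_pow, abs_of_pos (by positivity), div_mul_div_comm,
    one_mul]
  apply one_div_le_one_div_of_le (by positivity)
  rw [mul_comm]
  exact mul_le_mul_of_nonneg_left (cf_gamma_ge hν m) hf.le

lemma cf_summable {ν : ℝ} (hν : 0 ≤ ν) (t : ℝ) : Summable (fun m : ℕ => cf ν m * t ^ m) := by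
  refine Summable.of_norm_bounded
    (g := fun m : ℕ => (1 / Real.Gamma (ν + 1)) * (|t| ^ m / (m.factorial : ℝ))) ?_ ?_
  · exact (Real.summable_pow_div_factorial |t|).mul_left _
  · intro m
    rw [Real.norm_eq_abs, abs_mul, abs_pow]
    calc _ ≤ (1 / Real.Gamma (ν + 1)) * (1 / (m.factorial : ℝ)) * |t| ^ m := by
          gcongr; exact cf_bound hν m
      _ = _ := by ring

lemma cf_succ (ν : ℝ) (m : ℕ) : cf ν (m + 1) * ((m : ℝ) + 1) = - cf (ν + 1) m := by
  unfold cf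
  have h : (((m + 1 : ℕ) : ℝ) + ν + 1) = (m : ℝ) + (ν + 1) + 1 := by push_cast; ring
  rw [h, Nat.factorial_succ, pow_succ]
  push_cast
  have hf : (m.factorial : ℝ) ≠ 0 := by positivity
  have hm : (m : ℝ) + 1 ≠ 0 := by positivity
  by_cases hG : Real.Gamma ((m : ℝ) + (ν + 1) + 1) = 0
  · simp [hG]
  · field_simp

lemma FF_hasDerivAt {ν : ℝ} (hν : 0 ≤ ν) (t : ℝ) : HasDerivAt (FF ν) (- FF (ν + 1) t) t := by
  have key : HasDerivAt (fun z => ∑' m : ℕ, cf ν m * z ^ m)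
      (∑' m : ℕ, cf ν m * ((m : ℝ) * t ^ (m - 1))) t := by
    set R := |t| + 1 with hR
    have hR0 : 0 ≤ R := by positivity
    refine hasDerivAt_tsum_of_isPreconnected
      (u := fun m : ℕ => |cf ν m| * ((m : ℝ) * R ^ (m - 1)))
      (t := Metric.ball (0:ℝ) R) ?_ Metric.isOpen_ball (convex_ball _ _).isPreconnected
      (fun m y _ => (hasDerivAt_pow m y).const_mul _) ?_ (y₀ := 0) ?_ ?_ ?_
    · rw [← summable_nat_add_iff 1]
      have := (cf_summable (by linarith : (0:ℝ) ≤ ν + 1) R).abs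
      refine this.congr fun m => ?_
      have h2 := cf_succ ν m
      have hm : (0:ℝ) ≤ (m:ℝ) + 1 := by positivity
      rw [abs_mul, abs_pow, abs_of_nonneg hR0, ← abs_neg (cf (ν+1) m), ← h2, abs_mul,
        abs_of_nonneg hm]
      push_cast
      ring
    · intro m y hy
      rw [Metric.mem_ball, dist_zero_right, Real.norm_eq_abs] at hy
      rw [Real.norm_eq_abs, abs_mul, abs_mul, abs_pow, Nat.abs_cast]
      gcongr
    · simp [hR]; positivity
    · exact cf_summable hν 0
    · simp [hR]
  have h2 : (∑' m : ℕ, cf ν m * ((m : ℝ) * t ^ (m - 1))) = - FF (ν + 1) t := by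
    have hs : Summable (fun m : ℕ => cf ν m * ((m : ℝ) * t ^ (m - 1))) := by
      rw [← summable_nat_add_iff 1]
      refine (cf_summable (by linarith : (0:ℝ) ≤ ν + 1) t).neg.congr fun m => ?_
      have h2 := cf_succ ν m
      push_cast
      linear_combination (-t ^ m) * h2
    rw [hs.tsum_eq_zero_add]
    unfold FF
    rw [← tsum_neg]
    simp only [CharP.cast_eq_zero, zero_mul, mul_zero, zero_add]
    refine tsum_congr fun m => ?_
    have h2 := cf_succ ν m
    push_cast
    linear_combination (t ^ m) * h2
  rw [h2] at key
  exact key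

lemma FF_rec {ν : ℝ} (hν : 0 ≤ ν) (t : ℝ) :
    t * FF (ν + 1 + 1) t - (ν + 1) * FF (ν + 1) t + FF ν t = 0 := by
  have s0 := cf_summable hν t
  have s1 := cf_summable (by linarith : (0:ℝ) ≤ ν + 1) t
  have s2 := cf_summable (by linarith : (0:ℝ) ≤ ν + 1 + 1) t
  unfold FF
  rw [s0.tsum_eq_zero_add, s1.tsum_eq_zero_add, mul_add, ← tsum_mul_left, ← tsum_mul_left]
  have s0' := (summable_nat_add_iff 1).2 s0
  have s1' := ((summable_nat_add_iff 1).2 s1).mul_left (ν + 1)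
  have s2' := s2.mul_left t
  have h0 : cf ν 0 = (ν + 1) * cf (ν + 1) 0 := by
    unfold cf
    have : Real.Gamma (ν + 1 + 1) = (ν + 1) * Real.Gamma (ν + 1) :=
      Real.Gamma_add_one (by positivity)
    have hp : 0 < Real.Gamma (ν + 1) := Real.Gamma_pos_of_pos (by positivity)
    simp only [CharP.cast_eq_zero, zero_add, this]
    field_simp
  have hsum : (∑' m : ℕ, t * (cf (ν + 1 + 1) m * t ^ m))
      - (∑' m : ℕ, (ν + 1) * (cf (ν + 1) (m + 1) * t ^ (m + 1)))
      + ∑' m : ℕ, cf ν (m + 1) * t ^ (m + 1) = 0 := by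
    rw [← s2'.tsum_sub s1', ← (s2'.sub s1').tsum_add s0']
    rw [← tsum_zero (β := ℕ)]
    refine tsum_congr fun m => ?_
    have hm : (0:ℝ) ≤ m := Nat.cast_nonneg m
    have e : cf (ν + 1 + 1) m - (ν + 1) * cf (ν + 1) (m + 1) + cf ν (m + 1) = 0 := by
      unfold cf
      have e1 : (((m + 1 : ℕ) : ℝ) + ν + 1) = (m : ℝ) + ν + 2 := by push_cast; ring
      have e2 : (((m + 1 : ℕ) : ℝ) + (ν + 1) + 1) = (m : ℝ) + ν + 2 + 1 := by push_cast; ring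
      have e3 : ((m : ℝ) + (ν + 1 + 1) + 1) = (m : ℝ) + ν + 2 + 1 := by ring
      have hg : Real.Gamma ((m : ℝ) + ν + 2 + 1)
          = ((m : ℝ) + ν + 2) * Real.Gamma ((m : ℝ) + ν + 2) :=
        Real.Gamma_add_one (by positivity)
      have hp : 0 < Real.Gamma ((m : ℝ) + ν + 2) := Real.Gamma_pos_of_pos (by positivity)
      have hf : (m.factorial : ℝ) ≠ 0 := by positivity
      have hq : (m : ℝ) + ν + 2 ≠ 0 := by positivity
      have hm1 : (m : ℝ) + 1 ≠ 0 := by positivity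
      rw [e1, e2, e3, hg, Nat.factorial_succ, pow_succ]
      push_cast
      field_simp
      ring
    linear_combination (t ^ (m + 1)) * e
  linear_combination hsum + h0

lemma besselJ_eq {ν x : ℝ} (hx : 0 < x) :
    besselJ ν x = (x / 2) ^ ν * FF ν (x ^ 2 / 4) := by
  unfold besselJ FF cf
  rw [← tsum_mul_left]
  refine tsum_congr fun m => ?_
  have hx2 : 0 < x / 2 := by positivity
  have : (x / 2) ^ (2 * (m : ℝ) + ν) = (x / 2) ^ ν * (x ^ 2 / 4) ^ m := by
    rw [Real.rpow_add hx2, mul_comm]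
    congr 1
    have : (2 * (m : ℝ)) = ((2 * m : ℕ) : ℝ) := by push_cast; ring
    rw [this, Real.rpow_natCast, pow_mul]
    congr 1
    ring
  rw [this]; ring

lemma besselJ_deriv {ν x : ℝ} (hν : 0 ≤ ν) (hx : 0 < x) (h0 : besselJ ν x = 0) :
    FF ν (x ^ 2 / 4) = 0 ∧
    deriv (besselJ ν) x = (x / 2) ^ ν * (x / 2) * (- FF (ν + 1) (x ^ 2 / 4)) := by
  have hx2 : 0 < x / 2 := by positivity
  have hF : FF ν (x ^ 2 / 4) = 0 := by
    rw [besselJ_eq hx] at h0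
    exact (mul_eq_zero.1 h0).resolve_left (Real.rpow_pos_of_pos hx2 _).ne'
  refine ⟨hF, ?_⟩
  have hev : besselJ ν =ᶠ[nhds x] fun y => (y / 2) ^ ν * FF ν (y ^ 2 / 4) := by
    filter_upwards [lt_mem_nhds hx] with y hy using besselJ_eq hy
  rw [hev.deriv_eq]
  have d1 : HasDerivAt (fun y : ℝ => (y / 2) ^ ν) ((1 / 2) * ν * (x / 2) ^ (ν - 1)) x :=
    ((hasDerivAt_id x).div_const 2).rpow_const (Or.inl hx2.ne')
  have d2 : HasDerivAt (fun y : ℝ => y ^ 2 / 4) (x / 2) x := by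
    have := (hasDerivAt_pow 2 x).div_const 4
    refine this.congr_deriv ?_
    push_cast; ring
  have d3 := (FF_hasDerivAt hν (x ^ 2 / 4)).comp x d2
  have d4 := d1.mul d3
  have := d4.deriv
  simp only [Function.comp_def] at this
  change deriv (fun y => (y / 2) ^ ν * FF ν (y ^ 2 / 4)) x = _ at this
  rw [this, hF]
  ring

lemma FF_cont {ν : ℝ} (hν : 0 ≤ ν) : Continuous (FF ν) :=
  continuous_iff_continuousAt.2 fun t => (FF_hasDerivAt hν t).continuousAt

lemma FF_comp_deriv {ν : ℝ} (hν : 0 ≤ ν) (A s : ℝ) :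
    HasDerivAt (fun s => FF ν (A * s)) (- A * FF (ν + 1) (A * s)) s := by
  have h := (FF_hasDerivAt hν (A * s)).comp s ((hasDerivAt_id s).const_mul A)
  refine h.congr_deriv ?_
  ring

/-- Lommel's integral. -/
lemma lommel {ν q p : ℝ} (hq : 0 < q) (hp : p = q + 1) (hνq : ν = q / p) (A B : ℝ) :
    p * (A - B) * (∫ x in (0:ℝ)..1, (x ^ q * FF ν (A * x ^ p)) * (x ^ q * FF ν (B * x ^ p)))
      = FF ν B * A * FF (ν + 1) A - FF ν A * B * FF (ν + 1) B := by
  have hp0 : 0 < p := by linarith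
  have hν : 0 ≤ ν := by rw [hνq]; positivity
  have hνp : ν * p = q := by rw [hνq]; field_simp
  have hν1 : 0 ≤ ν + 1 := by linarith
  have c0 := FF_cont hν
  have c1 := FF_cont hν1
  have cx : ∀ r : ℝ, 0 ≤ r → Continuous fun x : ℝ => x ^ r :=
    fun r hr => Real.continuous_rpow_const hr
  have cq := cx q hq.le
  have cp := cx p hp0.le
  have c2 := cx (2 * q + 1) (by linarith)
  rw [← intervalIntegral.integral_const_mul]
  have := intervalIntegral.integral_eq_sub_of_hasDerivAt_of_le (a := (0:ℝ)) (b := 1) zero_le_one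
    (f := fun x => x ^ (2 * q + 1) * (FF ν (B * x ^ p) * (A * FF (ν + 1) (A * x ^ p))
        - FF ν (A * x ^ p) * (B * FF (ν + 1) (B * x ^ p))))
    (f' := fun x => p * (A - B) * ((x ^ q * FF ν (A * x ^ p)) * (x ^ q * FF ν (B * x ^ p))))
    (by fun_prop) ?_ (Continuous.intervalIntegrable (by fun_prop) _ _)
  · rw [this]
    simp only [Real.one_rpow, Real.zero_rpow hp0.ne', Real.zero_rpow (by linarith : 2 * q + 1 ≠ 0)]
    ring_nf
  · intro x hx
    have hx0 : 0 < x := hx.1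
    have dp : HasDerivAt (fun x : ℝ => x ^ p) (p * x ^ (p - 1)) x :=
      Real.hasDerivAt_rpow_const (Or.inl hx0.ne')
    have d2 : HasDerivAt (fun x : ℝ => x ^ (2 * q + 1))
        ((2 * q + 1) * x ^ (2 * q + 1 - 1)) x :=
      Real.hasDerivAt_rpow_const (Or.inl hx0.ne')
    have W : HasDerivAt (fun s => FF ν (B * s) * (A * FF (ν + 1) (A * s))
        - FF ν (A * s) * (B * FF (ν + 1) (B * s))) _ (x ^ p) :=
      ((FF_comp_deriv hν B (x ^ p)).mul ((FF_comp_deriv hν1 A (x ^ p)).const_mul A)).sub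
        ((FF_comp_deriv hν A (x ^ p)).mul ((FF_comp_deriv hν1 B (x ^ p)).const_mul B))
    have H := d2.mul (W.comp x dp)
    refine H.congr_deriv ?_
    have rA := FF_rec hν (A * x ^ p)
    have rB := FF_rec hν (B * x ^ p)
    have e1 : p - 1 = q := by linarith
    have e2 : x ^ (2 * q + 1 - 1) = x ^ q * x ^ q := by
      rw [← Real.rpow_add hx0]; congr 1; ring
    have e3 : x ^ (2 * q + 1) = x ^ q * x ^ p := by
      rw [← Real.rpow_add hx0]; congr 1; rw [hp]; ring
    have e4 : 2 * q + 1 = (ν + 1) * p := by rw [add_mul, hνp, hp]; ring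
    simp only [Function.comp_apply]
    rw [e1, e2, e3, e4]
    linear_combination (-p * x ^ q * x ^ q * A * FF ν (B * x ^ p)) * rA
      + (p * x ^ q * x ^ q * B * FF ν (A * x ^ p)) * rB

lemma lommel_diag {ν q p : ℝ} (hq : 0 < q) (hp : p = q + 1) (hνq : ν = q / p) (A : ℝ)
    (hA : FF ν A = 0) :
    p * A * (∫ x in (0:ℝ)..1, (x ^ q * FF ν (A * x ^ p)) * (x ^ q * FF ν (A * x ^ p)))
      = A ^ 2 * FF (ν + 1) A ^ 2 := by
  have hp0 : 0 < p := by linarith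
  have hν : 0 ≤ ν := by rw [hνq]; positivity
  have hνp : ν * p = q := by rw [hνq]; field_simp
  have hν1 : 0 ≤ ν + 1 := by linarith
  have c0 := FF_cont hν
  have c1 := FF_cont hν1
  have cx : ∀ r : ℝ, 0 ≤ r → Continuous fun x : ℝ => x ^ r :=
    fun r hr => Real.continuous_rpow_const hr
  have cq := cx q hq.le
  have cp := cx p hp0.le
  have c2 := cx (2 * q + 1) (by linarith)
  rw [← intervalIntegral.integral_const_mul]
  have := intervalIntegral.integral_eq_sub_of_hasDerivAt_of_le (a := (0:ℝ)) (b := 1) zero_le_one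
    (f := fun x => x ^ (2 * q + 1) * (x ^ p * (A ^ 2 * (FF (ν + 1) (A * x ^ p)
          * FF (ν + 1) (A * x ^ p)))
        + (A * (FF ν (A * x ^ p) * FF ν (A * x ^ p))
          - ν * A * (FF ν (A * x ^ p) * FF (ν + 1) (A * x ^ p)))))
    (f' := fun x => p * A * ((x ^ q * FF ν (A * x ^ p)) * (x ^ q * FF ν (A * x ^ p))))
    (by fun_prop) ?_ (Continuous.intervalIntegrable (by fun_prop) _ _)
  · rw [this]
    simp only [Real.one_rpow, Real.zero_rpow hp0.ne', Real.zero_rpow (by linarith : 2 * q + 1 ≠ 0),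
      mul_one, hA]
    ring_nf
  · intro x hx
    have hx0 : 0 < x := hx.1
    have dp : HasDerivAt (fun x : ℝ => x ^ p) (p * x ^ (p - 1)) x :=
      Real.hasDerivAt_rpow_const (Or.inl hx0.ne')
    have d2 : HasDerivAt (fun x : ℝ => x ^ (2 * q + 1))
        ((2 * q + 1) * x ^ (2 * q + 1 - 1)) x :=
      Real.hasDerivAt_rpow_const (Or.inl hx0.ne')
    have f0 := FF_comp_deriv hν A (x ^ p)
    have f1 := FF_comp_deriv hν1 A (x ^ p)
    have W : HasDerivAt (fun s => s * (A ^ 2 * (FF (ν + 1) (A * s) * FF (ν + 1) (A * s)))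
        + (A * (FF ν (A * s) * FF ν (A * s))
          - ν * A * (FF ν (A * s) * FF (ν + 1) (A * s)))) _ (x ^ p) :=
      ((hasDerivAt_id (x ^ p)).mul ((f1.mul f1).const_mul (A ^ 2))).add
        (((f0.mul f0).const_mul A).sub ((f0.mul f1).const_mul (ν * A)))
    have H := d2.mul (W.comp x dp)
    refine H.congr_deriv ?_
    have rA := FF_rec hν (A * x ^ p)
    have e1 : p - 1 = q := by linarith
    have e2 : x ^ (2 * q + 1 - 1) = x ^ q * x ^ q := by
      rw [← Real.rpow_add hx0]; congr 1; ring
    have e3 : x ^ (2 * q + 1) = x ^ q * x ^ p := by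
      rw [← Real.rpow_add hx0]; congr 1; rw [hp]; ring
    have e4 : 2 * q + 1 = (ν + 1) * p := by rw [add_mul, hνp, hp]; ring
    simp only [Function.comp_apply, id_eq, Pi.mul_apply]
    rw [e1, e2, e3, e4]
    linear_combination (p * x ^ q * x ^ q * A * (ν * FF ν (A * x ^ p)
      - 2 * A * x ^ p * FF (ν + 1) (A * x ^ p))) * rA

/-- Energy estimate near a zero. -/
lemma energy {ν : ℝ} (hν : 0 ≤ ν) (hν1 : ν ≤ 1) {S T μ : ℝ} (hS : 1 ≤ S) (hμ : 0 ≤ μ)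
    (hT : T = S + μ) (h0 : FF ν T = 0) :
    |FF ν S| ≤ exp (3 * μ) * |FF (ν + 1) T| ∧
    |FF ν S - μ * FF (ν + 1) T| ≤ 3 * exp (3 * μ) * μ ^ 2 / S * |FF (ν + 1) T| := by
  set D := FF (ν + 1) T with hD
  have hνp : 0 ≤ ν + 1 := by linarith
  have d0 := fun t => FF_hasDerivAt hν t
  have d1 := fun t => FF_hasDerivAt hνp t
  have E : ∀ t ∈ Set.Icc S T, FF ν t ^ 2 + FF (ν + 1) t ^ 2 ≤ (exp (3 * μ) * |D|) ^ 2 := by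
    have dE : ∀ t, HasDerivAt (fun t => exp (6 * t) * (FF ν t ^ 2 + FF (ν + 1) t ^ 2))
        (exp (6 * t) * 6 * (FF ν t ^ 2 + FF (ν + 1) t ^ 2) + exp (6 * t) *
          (2 * FF ν t * (- FF (ν + 1) t) + 2 * FF (ν + 1) t * (- FF (ν + 1 + 1) t))) t := by
      intro t
      have he : HasDerivAt (fun t : ℝ => exp (6 * t)) (exp (6 * t) * 6) t := by
        have := ((hasDerivAt_id t).const_mul 6).exp
        simpa using this
      have := he.mul (((d0 t).pow 2).add ((d1 t).pow 2))
      refine this.congr_deriv ?_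
      simp
    have mono : MonotoneOn (fun t => exp (6 * t) * (FF ν t ^ 2 + FF (ν + 1) t ^ 2))
        (Set.Icc S T) := by
      apply monotoneOn_of_deriv_nonneg (convex_Icc S T)
      · exact fun t _ => (dE t).continuousAt.continuousWithinAt
      · exact fun t _ => (dE t).differentiableAt.differentiableWithinAt
      · intro t ht
        rw [interior_Icc] at ht
        rw [(dE t).deriv]
        have ht1 : 1 ≤ t := hS.trans ht.1.le
        have hr := FF_rec hν t
        have h2 : |FF (ν + 1 + 1) t| ≤ 2 * |FF (ν + 1) t| + |FF ν t| := by
          have e : t * FF (ν + 1 + 1) t = (ν + 1) * FF (ν + 1) t - FF ν t := by linarith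
          have e1 : |t * FF (ν + 1 + 1) t| ≤ 2 * |FF (ν + 1) t| + |FF ν t| := by
            rw [e]
            refine (abs_sub _ _).trans ?_
            rw [abs_mul, abs_of_nonneg hνp]
            gcongr; linarith
          rw [abs_mul, abs_of_pos (by linarith)] at e1
          nlinarith [abs_nonneg (FF (ν + 1 + 1) t)]
        have h3 : |FF (ν + 1) t * FF (ν + 1 + 1) t| ≤
            |FF (ν + 1) t| * (2 * |FF (ν + 1) t| + |FF ν t|) := by
          rw [abs_mul]; gcongr
        have h4 := (abs_le.1 h3).2
        have h5 : FF ν t * FF (ν + 1) t ≤ |FF ν t| * |FF (ν + 1) t| := by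
          rw [← abs_mul]; exact le_abs_self _
        have h6 := sq_abs (FF ν t)
        have h7 := sq_abs (FF (ν + 1) t)
        have : 0 ≤ exp (6 * t) * (6 * (FF ν t ^ 2 + FF (ν + 1) t ^ 2) +
          (2 * FF ν t * (- FF (ν + 1) t) + 2 * FF (ν + 1) t * (- FF (ν + 1 + 1) t))) := by
          apply mul_nonneg (exp_pos _).le
          nlinarith [sq_nonneg (|FF ν t| - |FF (ν + 1) t|), sq_nonneg (|FF ν t|),
            sq_nonneg (|FF (ν + 1) t|)]
        linarith
    intro t ht
    have h := mono ht (Set.right_mem_Icc.2 (ht.1.trans ht.2)) ht.2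
    simp only [h0] at h
    rw [← hD] at h
    have he : exp (6 * T) ≤ exp (6 * t) * exp (3 * μ) ^ 2 := by
      rw [← Real.exp_nat_mul, ← Real.exp_add]
      apply Real.exp_le_exp.2
      push_cast
      linarith [ht.1]
    have hpos := exp_pos (6 * t)
    rw [mul_pow, sq_abs]
    refine le_of_mul_le_mul_left (h.trans ?_) hpos
    nlinarith [sq_nonneg D]
  have hK : 0 ≤ exp (3 * μ) * |D| := by positivity
  have b0 : ∀ t ∈ Set.Icc S T, |FF ν t| ≤ exp (3 * μ) * |D| := fun t ht =>
    abs_le_of_sq_le_sq' (by nlinarith [E t ht, sq_nonneg (FF (ν + 1) t)]) hK |> abs_le.2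
  have b1 : ∀ t ∈ Set.Icc S T, |FF (ν + 1) t| ≤ exp (3 * μ) * |D| := fun t ht =>
    abs_le_of_sq_le_sq' (by nlinarith [E t ht, sq_nonneg (FF ν t)]) hK |> abs_le.2
  have hST : S ≤ T := by linarith
  have hS0 : 0 < S := by linarith
  have b2 : ∀ t ∈ Set.Icc S T, |FF (ν + 1 + 1) t| ≤ 3 * (exp (3 * μ) * |D|) / S := by
    intro t ht
    have hr := FF_rec hν t
    have e : t * FF (ν + 1 + 1) t = (ν + 1) * FF (ν + 1) t - FF ν t := by linarith
    have e1 : |t * FF (ν + 1 + 1) t| ≤ 2 * |FF (ν + 1) t| + |FF ν t| := by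
      rw [e]
      refine (abs_sub _ _).trans ?_
      rw [abs_mul, abs_of_nonneg hνp]
      gcongr; linarith
    rw [abs_mul, abs_of_pos (by linarith [ht.1])] at e1
    rw [le_div_iff₀ hS0]
    nlinarith [abs_nonneg (FF (ν + 1 + 1) t), b0 t ht, b1 t ht, ht.1]
  have hSm : S ∈ Set.Icc S T := Set.left_mem_Icc.2 hST
  have hTm : T ∈ Set.Icc S T := Set.right_mem_Icc.2 hST
  refine ⟨b0 S hSm, ?_⟩
  have m1 : ∀ t ∈ Set.Icc S T, |FF (ν + 1) t - D| ≤ 3 * (exp (3 * μ) * |D|) / S * μ := by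
    intro t ht
    have := (convex_Icc S T).norm_image_sub_le_of_norm_hasDerivWithin_le
      (f := FF (ν + 1)) (f' := fun t => - FF (ν + 1 + 1) t)
      (C := 3 * (exp (3 * μ) * |D|) / S) (fun x _ => (d1 x).hasDerivWithinAt)
      (fun x hx => by rw [norm_neg]; exact b2 x hx) hTm ht
    rw [Real.norm_eq_abs, Real.norm_eq_abs] at this
    refine this.trans ?_
    gcongr
    rw [abs_le]; constructor <;> linarith [ht.1, ht.2]
  have m2 := (convex_Icc S T).norm_image_sub_le_of_norm_hasDerivWithin_le
      (f := fun t => FF ν t + t * D) (f' := fun t => - FF (ν + 1) t + 1 * D)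
      (C := 3 * (exp (3 * μ) * |D|) / S * μ)
      (fun x _ => ((d0 x).add ((hasDerivAt_id x).mul_const D)).hasDerivWithinAt)
      (fun x hx => by
        rw [Real.norm_eq_abs, one_mul, neg_add_eq_sub, abs_sub_comm]; exact m1 x hx) hTm hSm
  rw [Real.norm_eq_abs, Real.norm_eq_abs] at m2
  have e1 : FF ν S + S * D - (FF ν T + T * D) = FF ν S - μ * D := by rw [h0, hT]; ring
  have e2 : |S - T| = μ := by rw [abs_sub_comm, hT]; simp [abs_of_nonneg hμ]
  rw [e1, e2] at m2
  refine m2.trans (le_of_eq ?_)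
  ring

lemma sum_lemma (t : ℕ → ℕ → ℝ) (P : ℕ → Prop) (h0 : ∀ n k, 0 ≤ t n k)
    (h1 : ∀ n, P n → ∃ K : ℕ, ∃ C : ℝ, ∀ k : ℕ, K ≤ k → 1 ≤ k →
      t n k * (1 + ((n : ℝ) - k) ^ 2) ≤ C)
    (h2 : ∃ N : ℕ, ∃ C : ℝ, ∀ n, N ≤ n → P n → ∀ k, 1 ≤ k →
      t n k * (1 + ((n : ℝ) - k) ^ 2) ≤ C * (1 / (n : ℝ) ^ 2)) :
    Summable (fun p : {n : ℕ // P n} × {k : ℕ // 1 ≤ k} => t p.1.1 p.2.1) := by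
  obtain ⟨N, C, hC⟩ := h2
  have h1' : ∀ n, ∃ C : ℝ, P n → ∀ k : ℕ, 1 ≤ k → t n k * (1 + ((n : ℝ) - k) ^ 2) ≤ C := by
    intro n
    by_cases hP : P n
    · obtain ⟨K, C, h⟩ := h1 n hP
      refine ⟨|C| + ∑ k ∈ Finset.range K, t n k * (1 + ((n : ℝ) - k) ^ 2), fun _ k hk => ?_⟩
      have hnn : ∀ i ∈ Finset.range K, 0 ≤ t n i * (1 + ((n : ℝ) - i) ^ 2) :=
        fun i _ => mul_nonneg (h0 _ _) (by positivity)
      by_cases hkK : K ≤ k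
      · have := h k hkK hk
        have := le_abs_self C
        have := Finset.sum_nonneg hnn
        linarith
      · have := Finset.single_le_sum hnn (Finset.mem_range.2 (not_le.1 hkK))
        have := abs_nonneg C
        linarith
    · exact ⟨0, fun h => absurd h hP⟩
  choose c hc using h1'
  let a : ℕ → ℝ := fun n => if N ≤ n then |C| * (1 / (n : ℝ) ^ 2) else |c n|
  have ha0 : ∀ n, 0 ≤ a n := by
    intro n; simp only [a]; split_ifs <;> positivity
  have ha : Summable a := by
    have hs : Summable (fun n : ℕ => |C| * (1 / (n : ℝ) ^ 2)) :=
      (Real.summable_one_div_nat_pow.2 (by norm_num)).mul_left _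
    rw [← summable_nat_add_iff N] at hs ⊢
    refine hs.congr fun n => ?_
    simp [a]
  have hb : Summable (fun m : ℤ => 1 / (1 + (m : ℝ) ^ 2)) := by
    have hs : Summable (fun m : ℤ => 1 / (m : ℝ) ^ 2) :=
      Real.summable_one_div_int_pow.2 (by norm_num)
    refine (hs.add (summable_of_ne_finset_zero (s := {0})
      (f := fun m : ℤ => if m = 0 then (1:ℝ) else 0) ?_)).of_nonneg_of_le
      (fun m => by positivity) ?_
    · intro b hb; simpa using hb
    · intro m
      by_cases hm : m = 0
      · simp [hm]
      · have : (m : ℝ) ≠ 0 := by exact_mod_cast hm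
        simp only [hm, if_false, add_zero]
        apply one_div_le_one_div_of_le (by positivity)
        linarith
  have hab := ha.mul_of_nonneg hb ha0 (fun m => by positivity)
  let i : {n : ℕ // P n} × {k : ℕ // 1 ≤ k} → ℕ × ℤ := fun p => (p.1.1, (p.1.1 : ℤ) - p.2.1)
  have hi : Function.Injective i := by
    rintro ⟨⟨n, hn⟩, ⟨k, hk⟩⟩ ⟨⟨n', hn'⟩, ⟨k', hk'⟩⟩ h
    simp only [i, Prod.mk.injEq] at h
    obtain ⟨rfl, h⟩ := h
    have : k = k' := by omega
    subst this
    rfl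
  refine (hab.comp_injective hi).of_nonneg_of_le (fun p => h0 _ _) ?_
  rintro ⟨⟨n, hn⟩, ⟨k, hk⟩⟩
  simp only [Function.comp_apply, i]
  push_cast
  rw [mul_one_div, le_div_iff₀ (by positivity)]
  simp only [a]
  split_ifs with hN
  · refine (hC n hN hn k hk).trans ?_
    gcongr
    exact le_abs_self C
  · exact (hc n hn k hk).trans (le_abs_self _)

lemma gap_s16 {j : ℕ → ℝ} {ν C : ℝ} (hν : 0 ≤ ν)
    (hC : ∀ n : ℕ, 1 ≤ n → |j n - Real.pi * ((n : ℝ) + ν / 2 - 1 / 4)| ≤ C / (n : ℝ))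
    (n : ℕ) (hn : 1 ≤ n) (hnC : 4 * C ≤ n) :
    (n : ℝ) ≤ j n ∧ ∀ k : ℕ, 1 ≤ k → k ≠ n → 2 * |(n : ℝ) - k| ≤ |j n - j k| := by
  have hn1 : (1:ℝ) ≤ n := by exact_mod_cast hn
  have hpi := Real.pi_gt_three
  have hC0 : 0 ≤ C := by
    have := (abs_nonneg _).trans (hC 1 le_rfl)
    simpa using this
  have hn' := hC n hn
  have hCn : C / n ≤ 1 / 4 := by rw [div_le_iff₀ (by linarith)]; linarith
  constructor
  · have := (abs_le.1 hn').1
    have : Real.pi * ((n : ℝ) + ν / 2 - 1 / 4) ≥ 3 * ((n : ℝ) - 1 / 4) := by nlinarith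
    linarith
  · intro k hk hkn
    have hk1 : (1:ℝ) ≤ k := by exact_mod_cast hk
    have hk' := hC k hk
    have h1 : (1:ℝ) ≤ |(n : ℝ) - k| := by
      have : (1:ℤ) ≤ |(n : ℤ) - k| := Int.one_le_abs (by omega)
      exact_mod_cast this
    have hsum : C / n + C / k ≤ |(n : ℝ) - k| := by
      by_cases h : (n : ℝ) ≤ 2 * k
      · have : C / k ≤ 1 / 2 := by rw [div_le_iff₀ (by linarith)]; linarith
        linarith
      · have : C / k ≤ C := div_le_self hC0 hk1
        have := le_abs_self ((n : ℝ) - k)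
        linarith
    set en := j n - Real.pi * ((n : ℝ) + ν / 2 - 1 / 4)
    set ek := j k - Real.pi * ((k : ℝ) + ν / 2 - 1 / 4)
    have e : Real.pi * ((n : ℝ) - k) = (j n - j k) - en + ek := by simp only [en, ek]; ring
    have : Real.pi * |(n : ℝ) - k| ≤ |j n - j k| + |en| + |ek| := by
      rw [← abs_of_pos Real.pi_pos, ← abs_mul, e]
      exact (abs_add_le _ _).trans (add_le_add_left (abs_sub _ _) _)
    nlinarith

lemma phi_form {ν κ q p a x : ℝ} (hp : p = 2 * κ) (hνκ : κ * ν = q / 2) (ha : 0 < a)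
    (hx : 0 < x) : x ^ (q / 2) * besselJ ν (a * x ^ κ)
      = (a / 2) ^ ν * (x ^ q * FF ν (a ^ 2 / 4 * x ^ p)) := by
  have hxk : 0 < x ^ κ := Real.rpow_pos_of_pos hx _
  rw [besselJ_eq (by positivity)]
  have e1 : a * x ^ κ / 2 = (a / 2) * x ^ κ := by ring
  have e2 : (a * x ^ κ) ^ 2 / 4 = a ^ 2 / 4 * x ^ p := by
    have : x ^ p = x ^ κ * x ^ κ := by rw [← Real.rpow_add hx, hp]; congr 1; ring
    rw [this]; ring
  have e3 : x ^ q = x ^ (q / 2) * x ^ (q / 2) := by rw [← Real.rpow_add hx]; congr 1; ring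
  rw [e1, e2, Real.mul_rpow (by positivity) hxk.le, ← Real.rpow_mul hx.le, hνκ, e3]
  ring

/-- Integrals of `f_A f_B`. -/
noncomputable def II (ν q p A B : ℝ) : ℝ :=
  ∫ x in (0:ℝ)..1, (x ^ q * FF ν (A * x ^ p)) * (x ^ q * FF ν (B * x ^ p))

lemma int_form {ν q p : ℝ} (hν : 0 ≤ ν) (hq : 0 < q) (hp : 0 < p) {f g h : ℝ → ℝ}
    {a b c A B C : ℝ}
    (hf : ∀ x, 0 < x → f x = a * (x ^ q * FF ν (A * x ^ p)))
    (hg : ∀ x, 0 < x → g x = b * (x ^ q * FF ν (B * x ^ p)))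
    (hh : ∀ x, 0 < x → h x = c * (x ^ q * FF ν (C * x ^ p))) :
    ∫ x in (0:ℝ)..1, (f x - g x) * h x = a * c * II ν q p A C - b * c * II ν q p B C := by
  have c0 := FF_cont hν
  have cq : Continuous fun x : ℝ => x ^ q := Real.continuous_rpow_const hq.le
  have cp : Continuous fun x : ℝ => x ^ p := Real.continuous_rpow_const hp.le
  unfold II
  rw [← intervalIntegral.integral_const_mul, ← intervalIntegral.integral_const_mul,
    ← intervalIntegral.integral_sub (Continuous.intervalIntegrable (by fun_prop) _ _)
      (Continuous.intervalIntegrable (by fun_prop) _ _)]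
  apply intervalIntegral.integral_congr_ae
  refine Filter.Eventually.of_forall fun x hx => ?_
  rw [Set.uIoc_of_le zero_le_one] at hx
  rw [hf x hx.1, hg x hx.1, hh x hx.1]
  ring

set_option maxHeartbeats 1000000 in
/-- The double series
`∑_{n : λ_n > λ} ∑_{k ≥ 1} (λ_n/λ_k) (∫₀¹ (φ_n - ξ̃_n) φ_k dx)²` converges; this expresses
that `{√λ_n ξ̃_n}` is quadratically close to the orthonormal family `{√λ_n φ_n}` in
`D(A^{1/2})'`. -/
theorem stmt_16 (α ν κ : ℝ) (hα : α ∈ Set.Ioo (0:ℝ) 1)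
    (hν : ν = (1 - α) / (2 - α)) (hκ : κ = (2 - α) / 2)
    (j : ℕ → ℝ)
    (hjpos : ∀ n, 1 ≤ n → 0 < j n)
    (hjmono : ∀ m n, 1 ≤ m → m < n → j m < j n)
    (hjzero : ∀ n, 1 ≤ n → besselJ ν (j n) = 0)
    (hjtop : Filter.Tendsto j Filter.atTop Filter.atTop)
    (hasym : ∃ C : ℝ, ∀ n : ℕ, 1 ≤ n →
      |j n - Real.pi * ((n : ℝ) + ν / 2 - 1 / 4)| ≤ C / (n : ℝ))
    (hder : ∃ c₁ > (0:ℝ), ∃ c₂ > (0:ℝ), ∀ n, 1 ≤ n →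
      c₁ / Real.sqrt (j n) ≤ |deriv (besselJ ν) (j n)| ∧
      |deriv (besselJ ν) (j n)| ≤ c₂ / Real.sqrt (j n))
    (ev : ℕ → ℝ) (hev : ∀ n, ev n = (κ * j n) ^ 2)
    (lam : ℝ) (hlam : 0 < lam)
    (hnr1 : ∀ n, 1 ≤ n → lam ≠ ev n)
    (hnr2 : ∀ n k, 1 ≤ n → 1 ≤ k → lam - ev n ≠ ev k)
    (φ : ℕ → ℝ → ℝ)
    (hφ : ∀ n x, φ n x = Real.sqrt (2 * κ) * x ^ ((1 - α) / 2) *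
      besselJ ν (j n * x ^ κ) / deriv (besselJ ν) (j n))
    (ξ : ℕ → ℝ → ℝ)
    (hξ : ∀ n x, ξ n x = Real.sqrt (2 * κ) * x ^ ((1 - α) / 2) *
      besselJ ν ((Real.sqrt (ev n - lam) / κ) * x ^ κ) / deriv (besselJ ν) (j n)) :
    Summable (fun p : {n : ℕ // 1 ≤ n ∧ lam < ev n} × {k : ℕ // 1 ≤ k} =>
      (ev p.1.1 / ev p.2.1) *
        (∫ x in (0:ℝ)..1, (φ p.1.1 x - ξ p.1.1 x) * φ p.2.1 x) ^ 2) := by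
  obtain ⟨hα0, hα1⟩ := hα
  obtain ⟨C, hC⟩ := hasym
  obtain ⟨c₁, hc₁, c₂, hc₂, hd⟩ := hder
  have hκ0 : 0 < κ := by rw [hκ]; linarith
  obtain ⟨q, hq⟩ : ∃ q, q = 1 - α := ⟨_, rfl⟩
  obtain ⟨p, hp⟩ : ∃ p, p = 2 - α := ⟨_, rfl⟩
  have hq0 : 0 < q := by linarith
  have hp0 : 0 < p := by linarith
  have hpq : p = q + 1 := by linarith
  have hpκ : p = 2 * κ := by linarith
  have hνq : ν = q / p := by rw [hν, hq, hp]
  have hν0 : 0 ≤ ν := by rw [hνq]; positivity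
  have hν1 : ν ≤ 1 := by rw [hνq, div_le_one hp0]; linarith
  have hνκ : κ * ν = q / 2 := by
    rw [hνq]; have : κ = p / 2 := by linarith
    rw [this]; field_simp
  obtain ⟨μ, hμ⟩ : ∃ μ, μ = lam / (4 * κ ^ 2) := ⟨_, rfl⟩
  have hμ0 : 0 < μ := by rw [hμ]; positivity
  obtain ⟨T, hT⟩ : ∃ T : ℕ → ℝ, ∀ n, T n = j n ^ 2 / 4 := ⟨_, fun _ => rfl⟩
  obtain ⟨D, hD⟩ : ∃ D : ℕ → ℝ, ∀ n, D n = FF (ν + 1) (T n) := ⟨_, fun _ => rfl⟩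
  obtain ⟨r, hr⟩ : ∃ r : ℕ → ℝ, ∀ n, r n = (Real.sqrt (ev n - lam) / κ / 2) ^ ν / (j n / 2) ^ ν :=
    ⟨_, fun _ => rfl⟩
  obtain ⟨e, he⟩ : ∃ e : ℕ → ℝ, ∀ n, e n = Real.sqrt p / (j n / 2 * (- D n)) := ⟨_, fun _ => rfl⟩
  have hevT : ∀ n, ev n = 4 * κ ^ 2 * T n := fun n => by rw [hev, hT]; ring
  have hT0 : ∀ n, 1 ≤ n → 0 < T n := fun n hn => by
    rw [hT]; have := hjpos n hn; positivity
  have hFT : ∀ n, 1 ≤ n → FF ν (T n) = 0 := fun n hn => by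
    rw [hT]; exact (besselJ_deriv hν0 (hjpos n hn) (hjzero n hn)).1
  have hdJ : ∀ n, 1 ≤ n → deriv (besselJ ν) (j n) = (j n / 2) ^ ν * (j n / 2) * (- D n) :=
    fun n hn => by
      rw [hD, hT]; exact (besselJ_deriv hν0 (hjpos n hn) (hjzero n hn)).2
  have hD0 : ∀ n, 1 ≤ n → D n ≠ 0 := by
    intro n hn h
    have h1 := (hd n hn).1
    rw [hdJ n hn, h] at h1
    have := hjpos n hn
    have : 0 < c₁ / Real.sqrt (j n) := by positivity
    simp at h1
    linarith
  have hSpos : ∀ n, lam < ev n → 0 < T n - μ := by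
    intro n h
    rw [hevT] at h
    have : μ < T n := by rw [hμ, div_lt_iff₀ (by positivity)]; linarith
    linarith
  have hφ' : ∀ n, 1 ≤ n → ∀ x, 0 < x → φ n x = e n * (x ^ q * FF ν (T n * x ^ p)) := by
    intro n hn x hx
    have hj := hjpos n hn
    have hjn : 0 < (j n / 2) ^ ν := Real.rpow_pos_of_pos (by positivity) _
    rw [hφ, hdJ n hn, mul_assoc (Real.sqrt (2 * κ)), ← hq, phi_form hpκ hνκ hj hx, ← hpκ, he, hT n]
    have := hD0 n hn
    field_simp
  have hξ' : ∀ n, 1 ≤ n → lam < ev n → ∀ x, 0 < x →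
      ξ n x = (e n * r n) * (x ^ q * FF ν ((T n - μ) * x ^ p)) := by
    intro n hn hl x hx
    have hj := hjpos n hn
    have hjn : 0 < (j n / 2) ^ ν := Real.rpow_pos_of_pos (by positivity) _
    have hs : 0 < Real.sqrt (ev n - lam) := Real.sqrt_pos.2 (by linarith)
    have hb : (Real.sqrt (ev n - lam) / κ) ^ 2 / 4 = T n - μ := by
      rw [div_pow, Real.sq_sqrt (by linarith), hevT, hμ]
      field_simp
    rw [hξ, hdJ n hn, mul_assoc (Real.sqrt (2 * κ)), ← hq,
      phi_form hpκ hνκ (by positivity) hx, ← hpκ, he, hb, hr]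
    have := hD0 n hn
    field_simp
  have hr0 : ∀ n, 1 ≤ n → lam < ev n → 0 ≤ r n ∧ r n ≤ 1 ∧ 1 - r n ≤ μ / T n := by
    intro n hn hl
    have hj := hjpos n hn
    have hTn := hT0 n hn
    have hs : 0 < Real.sqrt (ev n - lam) := Real.sqrt_pos.2 (by linarith)
    have hb : (Real.sqrt (ev n - lam) / κ / 2) ^ 2 = T n - μ := by
      rw [div_pow, div_pow, Real.sq_sqrt (by linarith), hevT, hμ]
      field_simp
      ring
    have hrr : r n = (Real.sqrt (ev n - lam) / κ / 2 / (j n / 2)) ^ ν := by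
      rw [hr, ← Real.div_rpow (by positivity) (by positivity)]
    set y := Real.sqrt (ev n - lam) / κ / 2 / (j n / 2) with hy
    have hy0 : 0 < y := by positivity
    have hy2 : y ^ 2 = 1 - μ / T n := by
      have : (j n / 2) ^ 2 = T n := by rw [hT]; ring
      rw [hy, div_pow, hb, this]; field_simp
    have hmt : 0 < μ / T n := by positivity
    have hy1 : y ≤ 1 := by nlinarith
    rw [hrr]
    refine ⟨by positivity, Real.rpow_le_one hy0.le hy1 hν0, ?_⟩
    have h1 : y ^ (1:ℝ) ≤ y ^ ν := Real.rpow_le_rpow_of_exponent_ge hy0 hy1 hν1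
    rw [Real.rpow_one] at h1
    nlinarith
  have hint : ∀ n k, 1 ≤ n → lam < ev n → 1 ≤ k →
      (∫ x in (0:ℝ)..1, (φ n x - ξ n x) * φ k x)
        = e n * e k * II ν q p (T n) (T k) - e n * r n * e k * II ν q p (T n - μ) (T k) :=
    fun n k hn hl hk => int_form hν0 hq0 hp0 (hφ' n hn) (hξ' n hn hl) (hφ' k hk)
  have hIS : ∀ n k, 1 ≤ k → T n - μ - T k ≠ 0 → II ν q p (T n - μ) (T k)
      = - (FF ν (T n - μ) * T k * D k) / (p * (T n - μ - T k)) := by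
    intro n k hk hne
    have h := lommel hq0 hpq hνq (T n - μ) (T k)
    rw [hFT k hk, ← hD] at h
    rw [eq_div_iff (by positivity)]
    unfold II
    linear_combination h
  have hoff : ∀ n k, 1 ≤ n → lam < ev n → 1 ≤ k → k ≠ n → T n - μ - T k ≠ 0 →
      (ev n / ev k) * (∫ x in (0:ℝ)..1, (φ n x - ξ n x) * φ k x) ^ 2
        = (r n * FF ν (T n - μ) / D n / (T n - μ - T k)) ^ 2 := by
    intro n k hn hl hk hkn hne
    have hTT : T n - T k ≠ 0 := by
      have hjn := hjpos n hn
      have hjk := hjpos k hk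
      intro h
      rw [hT, hT] at h
      have h2 : j n = j k := by nlinarith
      rcases lt_or_gt_of_ne hkn with h' | h'
      · exact absurd h2 (hjmono k n hk h').ne'
      · exact absurd h2 (hjmono n k hn h').ne
    have hI0 : II ν q p (T n) (T k) = 0 := by
      have h := lommel hq0 hpq hνq (T n) (T k)
      rw [hFT k hk, hFT n hn] at h
      have h' : p * (T n - T k) * II ν q p (T n) (T k) = 0 := by
        unfold II; rw [h]; ring
      exact (mul_eq_zero.1 h').resolve_left (by positivity)
    rw [hint n k hn hl hk, hI0, hIS n k hk hne, he, he, hevT, hevT]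
    have hjn := hjpos n hn
    have hjk := hjpos k hk
    have hDn := hD0 n hn
    have hDk := hD0 k hk
    have hsp : Real.sqrt p ^ 2 = p := Real.sq_sqrt hp0.le
    have hsp4 : Real.sqrt p ^ 4 = p ^ 2 := by
      rw [← hsp]; ring_nf; rw [hsp]
    generalize FF ν (T n - μ) = F at *
    generalize hW : T n - μ - T k = W at *
    rw [hT n, hT k]
    generalize Real.sqrt p = sp at *
    field_simp
    rw [← hsp]
    ring
  have hdiag : ∀ n, 1 ≤ n → lam < ev n →
      (ev n / ev n) * (∫ x in (0:ℝ)..1, (φ n x - ξ n x) * φ n x) ^ 2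
        = (1 - r n * FF ν (T n - μ) / (D n * μ)) ^ 2 := by
    intro n hn hl
    have hTn := hT0 n hn
    have hjn := hjpos n hn
    have hDn := hD0 n hn
    have hI0 : II ν q p (T n) (T n) = T n * D n ^ 2 / p := by
      have h := lommel_diag hq0 hpq hνq (T n) (hFT n hn)
      rw [← hD] at h
      rw [eq_div_iff hp0.ne']
      have h' : T n * (II ν q p (T n) (T n) * p) = T n * (T n * D n ^ 2) := by
        unfold II; linear_combination h
      exact mul_left_cancel₀ hTn.ne' h'
    have hW : T n - μ - T n = -μ := by ring
    rw [hint n n hn hl hn, hI0, hIS n n hn (by rw [hW]; linarith), hW, he,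
      div_self (by linarith), one_mul]
    have hsp : Real.sqrt p ^ 2 = p := Real.sq_sqrt hp0.le
    generalize FF ν (T n - μ) = F at *
    rw [hT n]
    generalize Real.sqrt p = sp at *
    congr 1
    rw [← hsp] at hp0 ⊢
    have : sp ≠ 0 := by rintro rfl; simp at hp0
    field_simp
    ring
  have hgap := fun n hn hnC => gap_s16 hν0 hC n hn hnC
  have hTge : ∀ k : ℕ, 1 ≤ k → 4 * C ≤ k → (k : ℝ) ^ 2 / 4 ≤ T k := by
    intro k hk hkC
    have h := (hgap k hk hkC).1
    have : (0:ℝ) ≤ k := Nat.cast_nonneg k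
    rw [hT]; gcongr
  refine sum_lemma (fun n k => (ev n / ev k) * (∫ x in (0:ℝ)..1, (φ n x - ξ n x) * φ k x) ^ 2)
    (fun n => 1 ≤ n ∧ lam < ev n) ?_ ?_ ?_
  · intro n k
    have h1 : 0 ≤ ev n := by rw [hev]; positivity
    have h2 : 0 ≤ ev k := by rw [hev]; positivity
    positivity
  · rintro n ⟨hn, hl⟩
    have hS := hSpos n hl
    obtain ⟨K, hK⟩ := exists_nat_ge (4 * C + 8 * (T n - μ) + n + 1 + |C| * 4)
    set a := r n * FF ν (T n - μ) / D n with ha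
    refine ⟨K, 128 * a ^ 2, fun k hKk hk => ?_⟩
    have hkR : (K : ℝ) ≤ k := by exact_mod_cast hKk
    have hk1 : (1:ℝ) ≤ k := by exact_mod_cast hk
    have hn0 : (0:ℝ) ≤ n := Nat.cast_nonneg n
    have hCa := neg_abs_le C
    have hCb := abs_nonneg C
    have h4C : 4 * C ≤ k := by linarith
    have hTk := hTge k hk h4C
    have h8 : 8 * (T n - μ) ≤ k := by linarith
    have hnk : (n : ℝ) < k := by linarith
    have hW : (k : ℝ) ^ 2 / 8 ≤ T k - (T n - μ) := by nlinarith
    have hWp : 0 < T k - (T n - μ) := lt_of_lt_of_le (by positivity) hW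
    have hkn : k ≠ n := by rintro rfl; exact lt_irrefl _ hnk
    rw [hoff n k hn hl hk hkn (by linarith), ← ha, div_pow, div_mul_eq_mul_div,
      div_le_iff₀ (by rw [← neg_sub]; nlinarith)]
    have h1 : 1 + ((n : ℝ) - k) ^ 2 ≤ 2 * (k : ℝ) ^ 2 := by nlinarith
    have h2 : (k : ℝ) ^ 4 / 64 ≤ (T n - μ - T k) ^ 2 := by
      have := pow_le_pow_left₀ (by positivity) hW 2
      nlinarith
    have h3 : (k : ℝ) ^ 2 ≤ (k : ℝ) ^ 4 := pow_le_pow_right₀ hk1 (by norm_num)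
    calc a ^ 2 * (1 + ((n : ℝ) - k) ^ 2) ≤ a ^ 2 * (2 * (k : ℝ) ^ 4) := by
          gcongr; linarith
      _ = 128 * a ^ 2 * ((k : ℝ) ^ 4 / 64) := by ring
      _ ≤ _ := by gcongr
  · obtain ⟨N, hN⟩ := exists_nat_ge (4 * |C| + 8 * μ + 3)
    set E := exp (3 * μ) with hE
    have hE1 : 1 ≤ E := Real.one_le_exp (by positivity)
    refine ⟨N, 32 * E ^ 2 + (28 * E * μ) ^ 2, ?_⟩
    rintro n hNn ⟨hn, hl⟩ k hk
    have hnR : (N : ℝ) ≤ n := by exact_mod_cast hNn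
    have hCa := le_abs_self C
    have hCb := abs_nonneg C
    have h4C : 4 * C ≤ n := by linarith
    have hn3 : (3:ℝ) ≤ n := by linarith
    have h8μ : 8 * μ ≤ n := by linarith
    have hTn := hTge n hn h4C
    have hTn0 := hT0 n hn
    have hS8 : (n : ℝ) ^ 2 / 8 ≤ T n - μ := by nlinarith
    have hS1 : 1 ≤ T n - μ := by nlinarith
    obtain ⟨hr0', hr1, hr2⟩ := hr0 n hn hl
    have hDn := hD0 n hn
    have hDa : 0 < |D n| := abs_pos.2 hDn
    obtain ⟨en1, en2⟩ := energy hν0 hν1 hS1 hμ0.le (by ring : T n = T n - μ + μ) (hFT n hn)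
    rw [← hD, ← hE] at en1 en2
    generalize hF : FF ν (T n - μ) = F at *
    have hn2 : (0:ℝ) < (n : ℝ) ^ 2 := by positivity
    by_cases hkn : k = n
    · subst hkn
      rw [hdiag k hn hl, hF, sub_self]
      have hb : |1 - r k * F / (D k * μ)| ≤ 28 * E * μ / (k : ℝ) ^ 2 := by
        have e1 : 1 - r k * F / (D k * μ)
            = (1 - r k) - r k * ((F - μ * D k) / (D k * μ)) := by
          field_simp; ring
        have e2 : |(F - μ * D k) / (D k * μ)| ≤ 3 * E * μ / (T k - μ) := by
          rw [abs_div, abs_mul, abs_of_pos hμ0, div_le_iff₀ (by positivity)]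
          refine en2.trans (le_of_eq ?_)
          ring
        have e3 : 3 * E * μ / (T k - μ) ≤ 24 * E * μ / (k : ℝ) ^ 2 := by
          rw [div_le_div_iff₀ (by linarith) hn2]
          have : 0 ≤ E * μ := by positivity
          nlinarith
        have e4 : μ / T k ≤ 4 * E * μ / (k : ℝ) ^ 2 := by
          rw [div_le_div_iff₀ hTn0 hn2]
          have : μ * (k : ℝ) ^ 2 ≤ μ * (4 * T k) := by gcongr; linarith
          have : μ * (4 * T k) * 1 ≤ μ * (4 * T k) * E := by gcongr
          linarith
        have e5 : |r k * ((F - μ * D k) / (D k * μ))| ≤ 24 * E * μ / (k : ℝ) ^ 2 := by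
          rw [abs_mul, abs_of_nonneg hr0']
          have := abs_nonneg ((F - μ * D k) / (D k * μ))
          nlinarith
        rw [e1]
        refine (abs_sub _ _).trans ?_
        rw [abs_of_nonneg (by linarith : 0 ≤ 1 - r k)]
        have : 28 * E * μ / (k : ℝ) ^ 2 = 4 * E * μ / (k : ℝ) ^ 2 + 24 * E * μ / (k : ℝ) ^ 2 := by
          ring
        linarith
      have hb2 := pow_le_pow_left₀ (abs_nonneg _) hb 2
      rw [sq_abs] at hb2
      have h1 : (28 * E * μ / (k : ℝ) ^ 2) ^ 2 ≤ (28 * E * μ) ^ 2 * (1 / (k : ℝ) ^ 2) := by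
        rw [div_pow, mul_one_div]
        apply div_le_div_of_nonneg_left (by positivity) hn2
        have h9 : (1:ℝ) ≤ (k : ℝ) ^ 2 := one_le_pow₀ (by linarith)
        exact le_self_pow₀ h9 (by norm_num)
      have h2 : 0 ≤ 32 * E ^ 2 * (1 / (k : ℝ) ^ 2) := by positivity
      nlinarith
    · have hjn := hjpos n hn
      have hjk := hjpos k hk
      obtain ⟨g1, g2⟩ := hgap n hn h4C
      have g3 := g2 k hk hkn
      have h1 : (1:ℝ) ≤ |(n : ℝ) - k| := by
        have : (1:ℤ) ≤ |(n : ℤ) - k| := Int.one_le_abs (by omega)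
        exact_mod_cast this
      have g4 : (n : ℝ) * |(n : ℝ) - k| / 2 ≤ |T n - T k| := by
        have : T n - T k = (j n + j k) / 4 * (j n - j k) := by rw [hT, hT]; ring
        rw [this, abs_mul, abs_of_pos (by positivity : 0 < (j n + j k) / 4)]
        have : (n : ℝ) / 4 * (2 * |(n : ℝ) - k|) ≤ (j n + j k) / 4 * |j n - j k| := by
          gcongr; linarith
        linarith
      have g5 : (n : ℝ) * |(n : ℝ) - k| / 4 ≤ |T n - μ - T k| := by
        have e1 : T n - T k = (T n - μ - T k) + μ := by ring
        have e2 : |T n - T k| ≤ |T n - μ - T k| + μ := by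
          rw [e1]
          refine (abs_add_le _ _).trans ?_
          rw [abs_of_pos hμ0]
        have : μ ≤ (n : ℝ) * |(n : ℝ) - k| / 4 := by nlinarith
        linarith
      have hpos : 0 < (n : ℝ) * |(n : ℝ) - k| / 4 := by positivity
      have hne : T n - μ - T k ≠ 0 := abs_pos.1 (hpos.trans_le g5)
      rw [hoff n k hn hl hk hkn hne, hF]
      have hb : |r n * F / D n / (T n - μ - T k)| ≤ E / ((n : ℝ) * |(n : ℝ) - k| / 4) := by
        rw [abs_div]
        apply div_le_div₀ (by positivity) _ hpos g5
        rw [abs_div, div_le_iff₀ hDa, abs_mul, abs_of_nonneg hr0']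
        nlinarith [abs_nonneg F]
      have hb2 := pow_le_pow_left₀ (abs_nonneg _) hb 2
      rw [sq_abs] at hb2
      have hd2 : (1:ℝ) ≤ ((n : ℝ) - k) ^ 2 := by
        rw [← sq_abs]; exact one_le_pow₀ h1
      have hd0 : (0:ℝ) < ((n : ℝ) - k) ^ 2 := by linarith
      calc _ ≤ (E / ((n : ℝ) * |(n : ℝ) - k| / 4)) ^ 2 * (2 * ((n : ℝ) - k) ^ 2) := by
            gcongr; linarith
        _ = 32 * E ^ 2 * (1 / (n : ℝ) ^ 2) := by
            rw [div_pow, div_pow, mul_pow, sq_abs]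
            have hdne : (n : ℝ) - k ≠ 0 := fun h => by rw [h] at hd0; simp at hd0
            field_simp
            norm_num
        _ ≤ _ := by
            exact mul_le_mul_of_nonneg_right (le_add_of_nonneg_right (sq_nonneg _))
              (by positivity)
end
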